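/- Second Sampling Lemma: let F be a convergence determining sequence, let W ∈ 𝒲₁ be a probability-graphon and let k ≥ 2 be an integer. Then with probability at least 1 − exp(−k/(2 ln k)) one has both δ_{□,F}(W_X, W) ≤ 21/√(ln k) and δ_{□,F}(W_{𝔾(k,W)}, W) ≤ 22/√(ln k), where W_X is the empirical stepfunction built from the sample X = (X₁,…,X_k) of i.i.d. uniform random variables on [0,1], and 𝔾(k,W) is the random weighted graph built from the same sample X. -/

import Mathlib

open MeasureTheory Filter Topology
open scoped ENNReal NNReal

noncomputable section

namespace PG

/-- The unit square `[0,1]²`, with its product Lebesgue measure. -/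
abbrev Sq : Type := unitInterval × unitInterval

variable {Z : Type*} [MeasurableSpace Z] [TopologicalSpace Z]

/-! ### Measure-valued kernels and probability-graphons -/

/-- `W(A;·) = ∫_A W(x,y;·) dx dy` for a measure-valued kernel. -/
def kernelInt (W : Sq → Measure Z) (A : Set Sq) : Measure Z :=
  ((volume : Measure Sq).restrict A).bind W

/-- The measure `M_W = W([0,1]²;·)` associated with a (positive) measure-valued kernel. -/
def MW (W : Sq → Measure Z) : Measure Z := (volume : Measure Sq).bind W

/-- A probability-graphon: a measurable map from `[0,1]²` to probability measures on `Z`. -/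
def IsProbGraphon (W : Sq → Measure Z) : Prop :=
  (∀ A : Set Z, MeasurableSet A → Measurable fun p => W p A) ∧
    ∀ p, IsProbabilityMeasure (W p)

/-- Essential supremum of the total mass of a positive measure-valued kernel. -/
def TVboundPos (W : Sq → Measure Z) : ℝ≥0∞ :=
  essSup (fun p => W p Set.univ) (volume : Measure Sq)

/-- A (positive) measure-valued kernel: measurable and essentially bounded. -/
def IsPosKernel (W : Sq → Measure Z) : Prop :=
  (∀ A : Set Z, MeasurableSet A → Measurable fun p => W p A) ∧ TVboundPos W < ⊤

/-- Relabeling `W^φ` of a kernel by a map `φ : [0,1] → [0,1]`. -/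
def relabel (W : Sq → Measure Z) (φ : unitInterval → unitInterval) : Sq → Measure Z :=
  fun p => W (φ p.1, φ p.2)

/-- `φ` is a Lebesgue-measure-preserving map of `[0,1]`. -/
def IsMP (φ : unitInterval → unitInterval) : Prop :=
  MeasurePreserving φ (volume : Measure unitInterval) (volume : Measure unitInterval)

/-- Weak convergence of a sequence of (finite) measures on `Z`. -/
def WeakTendsto (μ : ℕ → Measure Z) (ν : Measure Z) : Prop :=
  ∀ f : BoundedContinuousFunction Z ℝ,
    Tendsto (fun n => ∫ x, f x ∂(μ n)) atTop (𝓝 (∫ x, f x ∂ν))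

/-- The cut distance `d_{□,m}` associated with a distance `d_m` on measures. -/
def cutDist (dm : Measure Z → Measure Z → ℝ) (U W : Sq → Measure Z) : ℝ :=
  ⨆ ST : {p : Set unitInterval × Set unitInterval // MeasurableSet p.1 ∧ MeasurableSet p.2},
    dm (kernelInt U (ST.val.1 ×ˢ ST.val.2)) (kernelInt W (ST.val.1 ×ˢ ST.val.2))

/-- The unlabeled cut distance `δ_□` associated with a distance `d` on kernels:
`δ_□(U,W) = inf_{φ ∈ S_{[0,1]}} d(U, W^φ)`. -/
def deltaCut (d : (Sq → Measure Z) → (Sq → Measure Z) → ℝ) (U W : Sq → Measure Z) : ℝ :=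
  ⨅ φ : {φ : unitInterval → unitInterval // IsMP φ ∧ Function.Bijective φ},
    d U (relabel W φ.val)

/-- Weak isomorphism of kernels: `U^φ = W^ψ` a.e. for some measure-preserving `φ, ψ`. -/
def WeakIso (U W : Sq → Measure Z) : Prop :=
  ∃ φ ψ : unitInterval → unitInterval, IsMP φ ∧ IsMP ψ ∧
    relabel U φ =ᵐ[(volume : Measure Sq)] relabel W ψ

/-- A family of kernels is tight if the family of measures `{M_W}` is tight. -/
def TightFamily (K : Set (Sq → Measure Z)) : Prop :=
  ∀ ε : ℝ≥0∞, 0 < ε → ∃ K₀ : Set Z, IsCompact K₀ ∧ ∀ W ∈ K, MW W K₀ᶜ ≤ ε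

/-- Invariance of a distance on probability-graphons under bijective
measure-preserving relabelings. -/
def Invariant (d : (Sq → Measure Z) → (Sq → Measure Z) → ℝ) : Prop :=
  ∀ U W : Sq → Measure Z, IsProbGraphon U → IsProbGraphon W →
    ∀ φ : unitInterval → unitInterval, IsMP φ → Function.Bijective φ →
      d (relabel U φ) (relabel W φ) = d U W

/-- Smoothness of a distance on probability-graphons: a.e. weak convergence implies
convergence in `d`. -/
def Smooth (d : (Sq → Measure Z) → (Sq → Measure Z) → ℝ) : Prop :=
  ∀ (Wn : ℕ → Sq → Measure Z) (W : Sq → Measure Z),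
    (∀ n, IsProbGraphon (Wn n)) → IsProbGraphon W →
    (∀ᵐ p ∂(volume : Measure Sq), WeakTendsto (fun n => Wn n p) (W p)) →
    Tendsto (fun n => d (Wn n) W) atTop (𝓝 0)

/-- `d` is a distance on the space `𝒲₁` of probability-graphons (where kernels that
agree a.e. are identified). -/
def IsGraphonDist (d : (Sq → Measure Z) → (Sq → Measure Z) → ℝ) : Prop :=
  (∀ U W, IsProbGraphon U → IsProbGraphon W → d U W = d W U) ∧
  (∀ U W, IsProbGraphon U → IsProbGraphon W → 0 ≤ d U W) ∧
  (∀ U V W, IsProbGraphon U → IsProbGraphon V → IsProbGraphon W → d U W ≤ d U V + d V W) ∧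
  (∀ U W, IsProbGraphon U → IsProbGraphon W →
    (d U W = 0 ↔ U =ᵐ[(volume : Measure Sq)] W))

/-- Distance axioms for `d` on a subset `M`. -/
def IsDistOnSet {α : Type*} (M : Set α) (d : α → α → ℝ) : Prop :=
  (∀ x ∈ M, ∀ y ∈ M, d x y = d y x) ∧
  (∀ x ∈ M, ∀ y ∈ M, 0 ≤ d x y) ∧
  (∀ x ∈ M, ∀ y ∈ M, ∀ z ∈ M, d x z ≤ d x y + d y z) ∧
  (∀ x ∈ M, ∀ y ∈ M, (d x y = 0 ↔ x = y))

/-- The set `ℳ≤1(Z)` of measures of total mass at most one. -/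
def SubProb (Z : Type*) [MeasurableSpace Z] : Set (Measure Z) := {μ | μ Set.univ ≤ 1}

/-- `d_m` is a distance on `ℳ≤1(Z)`. -/
def IsDistOnSubProb (dm : Measure Z → Measure Z → ℝ) : Prop :=
  IsDistOnSet (SubProb Z) dm

/-- `d_m` induces the weak topology on `ℳ≤1(Z)` (sequential formulation; the weak
topology on `ℳ≤1(Z)` is metrizable, so it is characterized by its convergent
sequences). -/
def InducesWeakTopologySub (dm : Measure Z → Measure Z → ℝ) : Prop :=
  ∀ (μn : ℕ → Measure Z) (μ : Measure Z), (∀ n, μn n ∈ SubProb Z) → μ ∈ SubProb Z →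
    (Tendsto (fun n => dm (μn n) μ) atTop (𝓝 0) ↔ WeakTendsto μn μ)

/-- Quasi-convexity of a distance on the convex set `ℳ₊(Z)` of finite measures. -/
def QuasiConvexPos (dm : Measure Z → Measure Z → ℝ) : Prop :=
  ∀ μ₁ μ₂ ν₁ ν₂ : Measure Z, IsFiniteMeasure μ₁ → IsFiniteMeasure μ₂ →
    IsFiniteMeasure ν₁ → IsFiniteMeasure ν₂ → ∀ a : ℝ≥0∞, a ≤ 1 →
    dm (a • μ₁ + (1 - a) • μ₂) (a • ν₁ + (1 - a) • ν₂) ≤ max (dm μ₁ ν₁) (dm μ₂ ν₂)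

/-! ### Finite partitions of `[0,1]` and the stepping operator -/

/-- A finite measurable partition of `[0,1]` (possibly with empty classes). -/
structure FinPartition : Type where
  n : ℕ
  part : Fin n → Set unitInterval
  measurableSet : ∀ i, MeasurableSet (part i)
  disjoint : ∀ i j, i ≠ j → Disjoint (part i) (part j)
  covers : (⋃ i, part i) = Set.univ

/-- `P` refines `Q`: every class of `P` is included in a class of `Q`. -/
def FinPartition.Refines (P Q : FinPartition) : Prop :=
  ∀ i, ∃ j, P.part i ⊆ Q.part j

/-- The stepping `W_𝒫` of a (positive) measure-valued kernel `W` with respect to a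
finite partition `𝒫`: on `S_i × S_j` it equals `W(S_i×S_j;·)/(λ(S_i)λ(S_j))`
(and the zero measure on classes of zero measure). -/
def stepping (W : Sq → Measure Z) (P : FinPartition) : Sq → Measure Z :=
  fun p => ∑ i : Fin P.n, ∑ j : Fin P.n,
    Set.indicator (P.part i ×ˢ P.part j)
      (fun _ => ((volume (P.part i)) * (volume (P.part j)))⁻¹ •
        kernelInt W (P.part i ×ˢ P.part j)) p

/-- Weak regularity of a distance on probability-graphons. -/
def WeaklyRegular (d : (Sq → Measure Z) → (Sq → Measure Z) → ℝ) : Prop :=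
  ∀ K : Set (Sq → Measure Z), (∀ W ∈ K, IsProbGraphon W) → TightFamily K →
    ∀ ε : ℝ, 0 < ε → ∃ m : ℕ, 0 < m ∧
      ∀ W ∈ K, ∀ Q : FinPartition, ∃ P : FinPartition,
        P.Refines Q ∧ P.n ≤ m * Q.n ∧ d W (stepping W P) < ε

/-- Regularity of a distance on probability-graphons with respect to the stepping
operator. -/
def SteppingRegular (d : (Sq → Measure Z) → (Sq → Measure Z) → ℝ) : Prop :=
  ∃ C₀ : ℝ, 0 < C₀ ∧ ∀ W U : Sq → Measure Z, IsProbGraphon W → IsProbGraphon U →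
    ∀ P : FinPartition, d W (stepping W P) ≤ C₀ * d W (stepping U P)

/-! ### Signed measure-valued kernels -/

/-- The signed measure associated with a finite measure (and junk value `0` on
non-finite measures). -/
def toSigned (μ : Measure Z) : SignedMeasure Z :=
  letI := Classical.dec (IsFiniteMeasure μ)
  if h : IsFiniteMeasure μ then @Measure.toSignedMeasure Z _ μ h else 0

/-- `W(A;·)` for a signed measure-valued kernel. -/
def skernelInt (W : Sq → SignedMeasure Z) (A : Set Sq) : SignedMeasure Z :=
  toSigned (((volume : Measure Sq).restrict A).bind
      fun p => (W p).toJordanDecomposition.posPart)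
    - toSigned (((volume : Measure Sq).restrict A).bind
      fun p => (W p).toJordanDecomposition.negPart)

/-- Total mass `‖s‖_TV` of the total variation of a signed measure. -/
def TVnorm (s : SignedMeasure Z) : ℝ≥0∞ := s.totalVariation Set.univ

/-- `‖W‖∞`, the essential supremum of the total variation masses of a signed
measure-valued kernel. -/
def TVbound (W : Sq → SignedMeasure Z) : ℝ≥0∞ :=
  essSup (fun p => TVnorm (W p)) (volume : Measure Sq)

/-- A signed measure-valued kernel: measurable in `(x,y)` and essentially bounded in
total variation. -/
def IsSignedKernel (W : Sq → SignedMeasure Z) : Prop :=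
  (∀ A : Set Z, MeasurableSet A → Measurable fun p => W p A) ∧ TVbound W < ⊤

/-- The measure `M_W = ∫ |W|(x,y;·) dx dy` of a signed measure-valued kernel. -/
def MWs (W : Sq → SignedMeasure Z) : Measure Z :=
  (volume : Measure Sq).bind fun p => (W p).totalVariation

/-- Tightness for a family of signed measure-valued kernels. -/
def TightFamilyS (K : Set (Sq → SignedMeasure Z)) : Prop :=
  ∀ ε : ℝ≥0∞, 0 < ε → ∃ K₀ : Set Z, IsCompact K₀ ∧ ∀ W ∈ K, MWs W K₀ᶜ ≤ ε

/-- Integral of a bounded continuous function against a signed measure. -/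
def sint (f : BoundedContinuousFunction Z ℝ) (s : SignedMeasure Z) : ℝ :=
  ∫ x, f x ∂s.toJordanDecomposition.posPart - ∫ x, f x ∂s.toJordanDecomposition.negPart

/-- Weak convergence of signed measures. -/
def WeakTendstoS (s : ℕ → SignedMeasure Z) (t : SignedMeasure Z) : Prop :=
  ∀ f : BoundedContinuousFunction Z ℝ,
    Tendsto (fun n => sint f (s n)) atTop (𝓝 (sint f t))

/-- Stepping of a signed measure-valued kernel with respect to a finite partition. -/
def steppingS (W : Sq → SignedMeasure Z) (P : FinPartition) : Sq → SignedMeasure Z :=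
  fun p => ∑ i : Fin P.n, ∑ j : Fin P.n,
    Set.indicator (P.part i ×ˢ P.part j)
      (fun _ => (((volume (P.part i)).toReal * (volume (P.part j)).toReal)⁻¹ : ℝ) •
        skernelInt W (P.part i ×ˢ P.part j)) p

/-- Cut distance for signed measure-valued kernels associated with a distance `d_m`
on signed measures. -/
def cutDistS (dm : SignedMeasure Z → SignedMeasure Z → ℝ) (U W : Sq → SignedMeasure Z) : ℝ :=
  ⨆ ST : {p : Set unitInterval × Set unitInterval // MeasurableSet p.1 ∧ MeasurableSet p.2},
    dm (skernelInt U (ST.val.1 ×ˢ ST.val.2)) (skernelInt W (ST.val.1 ×ˢ ST.val.2))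

/-- Quasi-convexity of a distance on a convex subset `M` of signed measures. -/
def QuasiConvexOn (M : Set (SignedMeasure Z)) (dm : SignedMeasure Z → SignedMeasure Z → ℝ) :
    Prop :=
  ∀ x₁ ∈ M, ∀ x₂ ∈ M, ∀ y₁ ∈ M, ∀ y₂ ∈ M, ∀ a : ℝ, 0 ≤ a → a ≤ 1 →
    dm (a • x₁ + (1 - a) • x₂) (a • y₁ + (1 - a) • y₂) ≤ max (dm x₁ y₁) (dm x₂ y₂)

/-! ### Convergence determining sequences and the associated norms -/

/-- `F` is a convergence determining sequence: `[0,1]`-valued bounded continuous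
functions, `F 0 = 1`, such that convergence of all moments `μ(f_k)` implies weak
convergence (for finite positive measures). -/
def IsConvDet (F : ℕ → BoundedContinuousFunction Z ℝ) : Prop :=
  F 0 = 1 ∧ (∀ k x, F k x ∈ Set.Icc (0:ℝ) 1) ∧
  ∀ (μn : ℕ → Measure Z) (μ : Measure Z), (∀ n, IsFiniteMeasure (μn n)) → IsFiniteMeasure μ →
    (∀ k, Tendsto (fun n => ∫ x, F k x ∂(μn n)) atTop (𝓝 (∫ x, F k x ∂μ))) →
    WeakTendsto μn μ

/-- `‖μ − ν‖_F = Σ_k 2^{-k} |μ(f_k) − ν(f_k)|` for positive measures. -/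
def Fdist (F : ℕ → BoundedContinuousFunction Z ℝ) (μ ν : Measure Z) : ℝ :=
  ∑' k : ℕ, (1/2 : ℝ) ^ k * |∫ x, F k x ∂μ - ∫ x, F k x ∂ν|

/-- The cut distance `d_{□,F}(U,W) = ‖U − W‖_{□,F}` on measure-valued kernels. -/
def cutDistF (F : ℕ → BoundedContinuousFunction Z ℝ) (U W : Sq → Measure Z) : ℝ :=
  ⨆ ST : {p : Set unitInterval × Set unitInterval // MeasurableSet p.1 ∧ MeasurableSet p.2},
    Fdist F (kernelInt U (ST.val.1 ×ˢ ST.val.2)) (kernelInt W (ST.val.1 ×ˢ ST.val.2))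

/-- The norm `‖s‖_F` of a signed measure. -/
def FnormS (F : ℕ → BoundedContinuousFunction Z ℝ) (s : SignedMeasure Z) : ℝ :=
  ∑' k : ℕ, (1/2 : ℝ) ^ k * |sint (F k) s|

/-- The cut norm `‖W‖_{□,F}` of a signed measure-valued kernel. -/
def cutNormFS (F : ℕ → BoundedContinuousFunction Z ℝ) (W : Sq → SignedMeasure Z) : ℝ :=
  ⨆ ST : {p : Set unitInterval × Set unitInterval // MeasurableSet p.1 ∧ MeasurableSet p.2},
    FnormS F (skernelInt W (ST.val.1 ×ˢ ST.val.2))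

/-- The norm `‖W‖_{2,F}` of a signed measure-valued kernel. -/
def norm2F (F : ℕ → BoundedContinuousFunction Z ℝ) (W : Sq → SignedMeasure Z) : ℝ :=
  Real.sqrt (∑' k : ℕ, (1/2 : ℝ) ^ k * ∫ p, (sint (F k) (W p)) ^ 2 ∂(volume : Measure Sq))

/-! ### Homomorphism densities and sampling -/

/-- The homomorphism density `t(F^g, W)` of a `C_b(Z)`-decorated finite directed graph
with vertex set `Fin v` and edge set `E` in a measure-valued kernel `W`. -/
def homDensity {v : ℕ} (E : Finset (Fin v × Fin v))
    (g : Fin v × Fin v → BoundedContinuousFunction Z ℝ) (W : Sq → Measure Z) : ℝ :=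
  ∫ x : Fin v → unitInterval,
    (∏ e ∈ E, ∫ z, g e z ∂(W (x e.1, x e.2))) ∂(volume : Measure (Fin v → unitInterval))

/-- The edge set of the complete directed graph on `k` vertices. -/
def completeEdges (k : ℕ) : Finset (Fin k × Fin k) :=
  Finset.univ.filter fun e => e.1 ≠ e.2

/-- The `i`-th step `((i)/k, (i+1)/k]` of the uniform partition of `[0,1]` into `k`
intervals. -/
def stepSet (k : ℕ) (i : Fin k) : Set unitInterval :=
  {t | (i : ℝ) / k < (t : ℝ) ∧ (t : ℝ) ≤ ((i : ℝ) + 1) / k}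

/-- The stepfunction `W_x` sampled from `W` at the points `x = (x₁, …, x_k)`. -/
def sample (W : Sq → Measure Z) {k : ℕ} (x : Fin k → unitInterval) : Sq → Measure Z :=
  fun p => ∑ i : Fin k, ∑ j : Fin k,
    Set.indicator (stepSet k i ×ˢ stepSet k j) (fun _ => W (x i, x j)) p

/-- The probability-graphon associated with the `Z`-weighted complete graph on `k`
vertices with weights `β`. -/
def graphonOfWeights {k : ℕ} (β : Fin k × Fin k → Z) : Sq → Measure Z :=
  fun p => ∑ i : Fin k, ∑ j : Fin k,
    Set.indicator (stepSet k i ×ˢ stepSet k j) (fun _ => Measure.dirac (β (i, j))) p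

/-- The joint law of `(X, (β_{ij}))` where `X` is uniform on `[0,1]^k` and, given `X`,
the weights `β_{ij}` are independent with respective laws `W(X_i, X_j;·)`. -/
def sampleLaw (W : Sq → Measure Z) (k : ℕ) :
    Measure ((Fin k → unitInterval) × (Fin k × Fin k → Z)) :=
  (volume : Measure (Fin k → unitInterval)).bind fun x =>
    (Measure.pi fun e : Fin k × Fin k => W (x e.1, x e.2)).map (Prod.mk x)


theorem sum_weight_mul_le {ι : Type*} [Fintype ι] (s c : ι → ℝ) (hs : ∀ i, s i ∈ Set.Icc (0:ℝ) 1) :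
    ∃ S : Finset ι, ∑ i, s i * c i ≤ ∑ i ∈ S, c i := by
  classical
  refine ⟨Finset.univ.filter fun i => 0 < c i, ?_⟩
  rw [Finset.sum_filter]
  refine Finset.sum_le_sum fun i _ => ?_
  obtain ⟨h0, h1⟩ := hs i
  split_ifs with h
  · nlinarith
  · exact mul_nonpos_of_nonneg_of_nonpos h0 (not_lt.mp h)

theorem sum_weight_mul_weight_le {ι κ : Type*} [Fintype ι] [Fintype κ] (B : ι → κ → ℝ) (K : ℝ)
    (hB : ∀ (S : Finset ι) (T : Finset κ), ∑ i ∈ S, ∑ j ∈ T, B i j ≤ K)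
    (s : ι → ℝ) (t : κ → ℝ) (hs : ∀ i, s i ∈ Set.Icc (0:ℝ) 1) (ht : ∀ i, t i ∈ Set.Icc (0:ℝ) 1) :
    ∑ i, ∑ j, s i * t j * B i j ≤ K := by
  obtain ⟨S, hS⟩ := sum_weight_mul_le s (fun i => ∑ j, t j * B i j) hs
  obtain ⟨T, hT⟩ := sum_weight_mul_le t (fun j => ∑ i ∈ S, B i j) ht
  calc ∑ i, ∑ j, s i * t j * B i j = ∑ i, s i * ∑ j, t j * B i j := by
        simp only [Finset.mul_sum, mul_assoc]
    _ ≤ ∑ i ∈ S, ∑ j, t j * B i j := hS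
    _ = ∑ j, t j * ∑ i ∈ S, B i j := by
        rw [Finset.sum_comm]; simp only [Finset.mul_sum]
    _ ≤ ∑ j ∈ T, ∑ i ∈ S, B i j := hT
    _ = ∑ i ∈ S, ∑ j ∈ T, B i j := Finset.sum_comm
    _ ≤ K := hB S T

/-- A permutation matching two labelings as well as possible. -/
theorem exists_perm_card_ne_le {α κ : Type*} [Fintype α] [DecidableEq α] [DecidableEq κ]
    (l p : α → κ) :
    ∃ (π : Equiv.Perm α) (A : Finset κ),
      (Finset.univ.filter fun a => l a ≠ p (π a)).card + (Finset.univ.filter fun a => p a ∈ A).card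
        = (Finset.univ.filter fun a => l a ∈ A).card := by
  let d : Equiv.Perm α → Finset α := fun π => Finset.univ.filter fun a => l a ≠ p (π a)
  have hd : ∀ π a, a ∈ d π ↔ l a ≠ p (π a) := fun π a => by simp [d]
  obtain ⟨π, -, hπ⟩ := Finset.exists_min_image (Finset.univ : Finset (Equiv.Perm α))
    (fun π => (d π).card) ⟨1, Finset.mem_univ _⟩
  have key : ∀ a ∈ d π, ∀ b ∈ d π, l a ≠ p (π b) := by
    intro a ha b hb hab
    have h1 := hπ (π * Equiv.swap a b) (Finset.mem_univ _)
    refine absurd h1 (not_le.mpr (Finset.card_lt_card ?_))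
    rw [Finset.ssubset_iff_of_subset]
    · refine ⟨a, ha, ?_⟩
      rw [hd]
      simp [hab]
    · intro c hc
      rw [hd, Equiv.Perm.mul_apply] at hc
      by_cases hca : c = a
      · exact hca ▸ ha
      by_cases hcb : c = b
      · exact hcb ▸ hb
      rwa [Equiv.swap_apply_of_ne_of_ne hca hcb, ← hd] at hc
  refine ⟨π, (d π).image l, ?_⟩
  have e1 : (Finset.univ.filter fun a => p a ∈ (d π).image l).card
      = (Finset.univ.filter fun a => p (π a) ∈ (d π).image l).card := by
    refine (Finset.card_bij (fun a _ => π a) ?_ ?_ ?_).symm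
    · intro a ha; simpa using ha
    · intro a _ b _ h; exact π.injective h
    · intro b hb; exact ⟨π.symm b, by simpa using hb, by simp⟩
  rw [e1]
  change (d π).card + _ = _
  rw [← Finset.card_union_of_disjoint]
  · congr 1
    ext a
    simp only [Finset.mem_union, Finset.mem_filter_univ, Finset.mem_image]
    constructor
    · rintro (h | ⟨b, hb, h⟩)
      · exact ⟨a, h, rfl⟩
      · by_cases ha : a ∈ d π
        · exact absurd h (key b hb a ha)
        · rw [hd, not_not] at ha
          exact ⟨b, hb, h.trans ha.symm⟩
    · rintro ⟨b, hb, h⟩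
      by_cases ha : a ∈ d π
      · exact Or.inl ha
      · rw [hd, not_not] at ha
        exact Or.inr ⟨b, hb, h.trans ha⟩
  · rw [Finset.disjoint_left]
    intro a ha h
    simp only [Finset.mem_filter_univ, Finset.mem_image] at h
    obtain ⟨b, hb, h⟩ := h
    exact key b hb a ha h

/-- Greedy form of Maurey's lemma. -/
theorem exists_sum_sq_le {ι β : Type*} [Fintype ι] [Nonempty ι] [Fintype β] (ρ : β → ℝ)
    (z : ι → β → ℝ) (hz : ∀ b, ∑ i, z i b = 0) (R : ℝ)
    (hR : ∀ i, ∑ b, ρ b * z i b ^ 2 ≤ R) (q : ℕ) :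
    ∃ w : Fin q → ι, ∑ b, ρ b * (∑ l, z (w l) b) ^ 2 ≤ q * R := by
  induction q with
  | zero => exact ⟨Fin.elim0, by simp⟩
  | succ q ih =>
    obtain ⟨w, hw⟩ := ih
    have h0 : ∑ i, ∑ b, ρ b * ((∑ l, z (w l) b) * z i b) = 0 := by
      rw [Finset.sum_comm]
      refine Finset.sum_eq_zero fun b _ => ?_
      rw [← Finset.mul_sum, ← Finset.mul_sum, hz b]; simp
    obtain ⟨i, -, hi⟩ : ∃ i ∈ (Finset.univ : Finset ι),
        ∑ b, ρ b * ((∑ l, z (w l) b) * z i b) ≤ 0 := by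
      by_contra! hcon
      have := Finset.sum_pos hcon Finset.univ_nonempty
      linarith
    refine ⟨Fin.snoc w i, ?_⟩
    have e : ∑ b, ρ b * (∑ l, z ((Fin.snoc w i : Fin (q+1) → ι) l) b) ^ 2
        = ∑ b, ρ b * (∑ l, z (w l) b) ^ 2 + 2 * ∑ b, ρ b * ((∑ l, z (w l) b) * z i b)
          + ∑ b, ρ b * z i b ^ 2 := by
      rw [Finset.mul_sum, ← Finset.sum_add_distrib, ← Finset.sum_add_distrib]
      refine Finset.sum_congr rfl fun b _ => ?_
      rw [Fin.sum_univ_castSucc]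
      simp only [Fin.snoc_castSucc, Fin.snoc_last]
      ring
    rw [e]
    push_cast
    linarith [hR i]

theorem sum_mul_abs_le_sqrt {β : Type*} [Fintype β] (ρ f : β → ℝ) (hρ : ∀ b, 0 ≤ ρ b) :
    ∑ b, ρ b * |f b| ≤ √((∑ b, ρ b) * ∑ b, ρ b * f b ^ 2) := by
  refine Real.le_sqrt_of_sq_le ?_
  have := Finset.sum_sq_le_sum_mul_sum_of_sq_le_mul Finset.univ (r := fun b => ρ b * |f b|)
    (f := ρ) (g := fun b => ρ b * f b ^ 2) (fun b _ => hρ b)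
    (fun b _ => mul_nonneg (hρ b) (sq_nonneg _)) (fun b _ => by
      rw [mul_pow, sq_abs]; exact (by ring : ρ b ^ 2 * f b ^ 2 = _).le)
  exact this

/-- Approximation of an average of `[-1,1]`-valued functions by the average of a few of them. -/
theorem exists_tuple_average_close {ι β : Type*} [Fintype ι] [Nonempty ι] [Fintype β] (ρ : β → ℝ)
    (hρ : ∀ b, 0 ≤ ρ b) (u : ι → β → ℝ) (hu : ∀ i b, |u i b| ≤ 1) (q : ℕ) (hq : 0 < q) :
    ∃ w : Fin q → ι, ∑ b, ρ b * |(∑ i, u i b) / Fintype.card ι - (∑ l, u (w l) b) / q|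
      ≤ 2 * (∑ b, ρ b) / √q := by
  have hc : (0:ℝ) < Fintype.card ι := by exact_mod_cast Fintype.card_pos
  have hq' : (0:ℝ) < q := by exact_mod_cast hq
  set m : β → ℝ := fun b => (∑ i, u i b) / Fintype.card ι with hm
  have hm1 : ∀ b, |m b| ≤ 1 := by
    intro b
    rw [hm]; simp only
    rw [abs_div, abs_of_pos hc, div_le_one hc]
    refine (Finset.abs_sum_le_sum_abs _ _).trans ?_
    refine (Finset.sum_le_sum fun i _ => hu i b).trans ?_
    simp
  obtain ⟨w, hw⟩ := exists_sum_sq_le ρ (fun i b => u i b - m b)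
    (by intro b
        rw [Finset.sum_sub_distrib]
        simp [hm]; field_simp; simp) (4 * ∑ b, ρ b)
    (by intro i
        rw [Finset.mul_sum]
        refine Finset.sum_le_sum fun b _ => ?_
        have h1 := abs_le.mp (hu i b)
        have h2 := abs_le.mp (hm1 b)
        have : (u i b - m b) ^ 2 ≤ 4 := by nlinarith
        nlinarith [hρ b]) q
  refine ⟨w, ?_⟩
  refine (sum_mul_abs_le_sqrt ρ _ hρ).trans ?_
  have hs : 0 ≤ ∑ b, ρ b := Finset.sum_nonneg fun b _ => hρ b
  rw [Real.sqrt_le_left (by positivity)]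
  have e : ∑ b, ρ b * (m b - (∑ l, u (w l) b) / q) ^ 2
      = (∑ b, ρ b * (∑ l, (u (w l) b - m b)) ^ 2) / q ^ 2 := by
    rw [Finset.sum_div]
    refine Finset.sum_congr rfl fun b _ => ?_
    rw [Finset.sum_sub_distrib]
    simp
    field_simp
    ring
  rw [e, div_pow, mul_pow, Real.sq_sqrt hq'.le]
  calc (∑ b, ρ b) * ((∑ b, ρ b * (∑ l, (u (w l) b - m b)) ^ 2) / q ^ 2)
      ≤ (∑ b, ρ b) * ((q * (4 * ∑ b, ρ b)) / q ^ 2) := by gcongr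
    _ = (2 ^ 2 * (∑ b, ρ b) ^ 2) / q := by field_simp; norm_num
    _ = _ := by ring

/-- Weak regularity lemma for a weighted family of `[0,1]`-valued matrices. -/
theorem exists_weak_regular_labeling {α ι : Type*} [Fintype α] [Nonempty α] [Fintype ι]
    (c : ι → ℝ) (hc : ∀ n, 0 ≤ c n) (hc1 : ∑ n, c n ≤ 1)
    (M : ι → α → α → ℝ) (hM : ∀ n a b, M n a b ∈ Set.Icc (0:ℝ) 1)
    (ε : ℝ) (hε : 0 ≤ ε) (r : ℕ) (hr : 1 < r * ε ^ 2) :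
    ∃ (p : α → ℕ) (w : ι → ℕ → ℕ → ℝ), (∀ a, p a < 4 ^ r) ∧
      (∀ n u v, w n u v ∈ Set.Icc (0:ℝ) 1) ∧
      ∀ S T : Finset α, ∑ n, c n * |∑ a ∈ S, ∑ b ∈ T, (M n a b - w n (p a) (p b))|
        ≤ ε * Fintype.card α ^ 2 := by
  classical
  by_contra! hcon
  have hN : (0:ℝ) < Fintype.card α := by exact_mod_cast Fintype.card_pos
  set N : ℝ := (Fintype.card α : ℝ)
  have key : ∀ j ≤ r, ∃ (p : α → ℕ) (w : ι → ℕ → ℕ → ℝ), (∀ a, p a < 4 ^ j) ∧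
      (∀ n u v, w n u v ∈ Set.Icc (0:ℝ) 1) ∧
      ∑ n, c n * ∑ a, ∑ b, (M n a b - w n (p a) (p b)) ^ 2 ≤ (1 - j * ε ^ 2) * N ^ 2 := by
    intro j
    induction j with
    | zero =>
      intro _
      refine ⟨fun _ => 0, fun _ _ _ => 0, by simp, by simp, ?_⟩
      have h1 : ∀ n, ∑ a, ∑ b, (M n a b - 0) ^ 2 ≤ N ^ 2 := by
        intro n
        calc ∑ a, ∑ b, (M n a b - 0) ^ 2 ≤ ∑ _a : α, ∑ _b : α, (1:ℝ) := by
              gcongr with a _ b _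
              obtain ⟨h0, h1⟩ := hM n a b
              nlinarith
          _ = N ^ 2 := by simp [N]; ring
      calc ∑ n, c n * ∑ a, ∑ b, (M n a b - 0) ^ 2 ≤ ∑ n, c n * N ^ 2 := by
            gcongr with n _
            · exact hc n
            · exact h1 n
        _ = (∑ n, c n) * N ^ 2 := by rw [Finset.sum_mul]
        _ ≤ _ := by simpa using mul_le_mul_of_nonneg_right hc1 (sq_nonneg N)
    | succ j ih =>
      intro hj
      obtain ⟨p, w, hp, hw, hE⟩ := ih (by omega)
      obtain ⟨S, T, hST⟩ := hcon p w
        (fun a => (hp a).trans_le (Nat.pow_le_pow_right (by norm_num) (by omega))) hw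
      set d : ι → ℝ := fun n => ∑ a ∈ S, ∑ b ∈ T, (M n a b - w n (p a) (p b)) with hd
      let clip : ℝ → ℝ := fun y => max 0 (min 1 y)
      have hclip : ∀ y, clip y ∈ Set.Icc (0:ℝ) 1 := fun y =>
        ⟨le_max_left _ _, max_le zero_le_one (min_le_left _ _)⟩
      have hclip2 : ∀ x ∈ Set.Icc (0:ℝ) 1, ∀ y, (x - clip y) ^ 2 ≤ (x - y) ^ 2 := by
        rintro x ⟨hx0, hx1⟩ y
        simp only [clip]
        rcases le_total 1 y with h | h
        · rw [min_eq_left h, max_eq_right zero_le_one]; nlinarith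
        · rw [min_eq_right h]
          rcases le_total 0 y with h' | h'
          · rw [max_eq_right h']
          · rw [max_eq_left h']; nlinarith
      let p' : α → ℕ := fun a => 4 * p a + ((if a ∈ S then 2 else 0) + (if a ∈ T then 1 else 0))
      have hp' : ∀ a, p' a / 4 = p a ∧ (2 ≤ p' a % 4 ↔ a ∈ S) ∧ (p' a % 2 = 1 ↔ a ∈ T) := by
        intro a
        simp only [p']
        split_ifs with h1 h2 h2 <;> simp only [h1, h2, iff_true, iff_false] <;> omega
      let w' : ι → ℕ → ℕ → ℝ := fun n u v =>
        clip (w n (u / 4) (v / 4) + if 2 ≤ u % 4 ∧ v % 2 = 1 then d n / N ^ 2 else 0)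
      refine ⟨p', w', ?_, fun n u v => hclip _, ?_⟩
      · intro a
        have := hp a
        simp only [p']
        rw [pow_succ]
        split_ifs <;> omega
      · have h1 : ∀ n, ∑ a, ∑ b, (M n a b - w' n (p' a) (p' b)) ^ 2
            ≤ ∑ a, ∑ b, (M n a b - w n (p a) (p b)) ^ 2 - d n ^ 2 / N ^ 2 := by
          intro n
          have hpt : ∀ a b, (M n a b - w' n (p' a) (p' b)) ^ 2
              ≤ (M n a b - w n (p a) (p b)) ^ 2
                - 2 * (d n / N ^ 2) * (if a ∈ S then (if b ∈ T then
                    (M n a b - w n (p a) (p b)) else 0) else 0) + (d n / N ^ 2) ^ 2 := by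
            intro a b
            refine (hclip2 _ (hM n a b) _).trans ?_
            rw [(hp' a).1, (hp' b).1]
            simp only [(hp' a).2.1, (hp' b).2.2]
            by_cases ha : a ∈ S <;> by_cases hb : b ∈ T <;> simp only [ha, hb, and_true, and_false,
              if_true, if_false] <;> nlinarith [sq_nonneg (d n / N ^ 2)]
          refine (Finset.sum_le_sum fun a _ => Finset.sum_le_sum fun b _ => hpt a b).trans ?_
          simp only [Finset.sum_add_distrib, Finset.sum_sub_distrib, ← Finset.mul_sum]
          have hds : ∑ a, ∑ b, (if a ∈ S then (if b ∈ T then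
                    (M n a b - w n (p a) (p b)) else 0) else 0) = d n := by
            have hS : ∀ a, ∑ b, (if a ∈ S then (if b ∈ T then
                    (M n a b - w n (p a) (p b)) else 0) else 0)
                = if a ∈ S then ∑ b ∈ T, (M n a b - w n (p a) (p b)) else 0 := by
              intro a
              split_ifs
              · rw [Finset.sum_ite_mem, Finset.univ_inter]
              · exact Finset.sum_const_zero
            simp only [hS]
            rw [Finset.sum_ite_mem, Finset.univ_inter]
          rw [hds]
          simp only [Finset.sum_const, Finset.card_univ, nsmul_eq_mul]
          change _ - _ + N * (N * (d n / N ^ 2) ^ 2) ≤ _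
          apply le_of_eq
          field_simp
          ring
        have h2 : (ε * N ^ 2) ^ 2 ≤ ∑ n, c n * d n ^ 2 := by
          have h3 : (∑ n, c n * |d n|) ^ 2 ≤ (∑ n, c n) * ∑ n, c n * d n ^ 2 :=
            Finset.sum_sq_le_sum_mul_sum_of_sq_le_mul Finset.univ (r := fun n => c n * |d n|)
              (f := c) (g := fun n => c n * d n ^ 2) (fun n _ => hc n)
              (fun n _ => mul_nonneg (hc n) (sq_nonneg _))
              (fun n _ => by rw [mul_pow, sq_abs]; exact (by ring : c n ^ 2 * d n ^ 2 = _).le)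
          have h4 : (0:ℝ) ≤ ∑ n, c n * d n ^ 2 :=
            Finset.sum_nonneg fun n _ => mul_nonneg (hc n) (sq_nonneg _)
          have h5 : (ε * N ^ 2) ^ 2 ≤ (∑ n, c n * |d n|) ^ 2 := by gcongr
          nlinarith
        calc ∑ n, c n * ∑ a, ∑ b, (M n a b - w' n (p' a) (p' b)) ^ 2
            ≤ ∑ n, c n * (∑ a, ∑ b, (M n a b - w n (p a) (p b)) ^ 2 - d n ^ 2 / N ^ 2) := by
              gcongr with n _
              · exact hc n
              · exact h1 n
          _ = ∑ n, c n * ∑ a, ∑ b, (M n a b - w n (p a) (p b)) ^ 2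
                - (∑ n, c n * d n ^ 2) / N ^ 2 := by
              rw [Finset.sum_div, ← Finset.sum_sub_distrib]
              refine Finset.sum_congr rfl fun n _ => ?_
              ring
          _ ≤ (1 - j * ε ^ 2) * N ^ 2 - (ε * N ^ 2) ^ 2 / N ^ 2 := by gcongr
          _ = _ := by push_cast; field_simp; ring
  obtain ⟨p, w, -, -, hE⟩ := key r le_rfl
  have h0 : 0 ≤ ∑ n, c n * ∑ a, ∑ b, (M n a b - w n (p a) (p b)) ^ 2 :=
    Finset.sum_nonneg fun n _ => mul_nonneg (hc n)
      (Finset.sum_nonneg fun a _ => Finset.sum_nonneg fun b _ => sq_nonneg _)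
  nlinarith [sq_nonneg N, pow_pos hN 2]

/-- Hoeffding's inequality on a finite product of probability spaces. -/
theorem pi_measure_hoeffding_le {ι : Type*} [Fintype ι] {Ω : ι → Type*}
    [∀ i, MeasurableSpace (Ω i)] (μ : ∀ i, Measure (Ω i)) [∀ i, IsProbabilityMeasure (μ i)]
    (X : ∀ i, Ω i → ℝ) (hX : ∀ i, Measurable (X i)) (hb : ∀ i a, X i a ∈ Set.Icc (-1:ℝ) 1)
    (t : ℝ) (ht : 0 ≤ t) :
    Measure.pi μ {ω | t * Fintype.card ι ≤ ∑ i, (X i (ω i) - ∫ a, X i a ∂μ i)}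
      ≤ ENNReal.ofReal (Real.exp (-(Fintype.card ι * t ^ 2 / 2))) := by
  have hind : ProbabilityTheory.iIndepFun
      (fun i (ω : ∀ i, Ω i) => X i (ω i) - ∫ a, X i a ∂μ i) (Measure.pi μ) :=
    ProbabilityTheory.iIndepFun_pi (X := fun i a => X i a - ∫ a, X i a ∂μ i)
      (fun i => ((hX i).sub_const _).aemeasurable)
  have hsub : ∀ i ∈ (Finset.univ : Finset ι), ProbabilityTheory.HasSubgaussianMGF
      (fun ω : ∀ i, Ω i => X i (ω i) - ∫ a, X i a ∂μ i) 1 (Measure.pi μ) := by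
    intro i _
    have h := ProbabilityTheory.hasSubgaussianMGF_of_mem_Icc (μ := Measure.pi μ)
      (X := fun ω : ∀ i, Ω i => X i (ω i)) (a := -1) (b := 1)
      ((hX i).comp (measurable_pi_apply i)).aemeasurable (ae_of_all _ fun ω => hb i (ω i))
    have e1 : ∫ ω : ∀ i, Ω i, X i (ω i) ∂Measure.pi μ = ∫ a, X i a ∂μ i :=
      integral_comp_eval (hX i).aestronglyMeasurable
    have e2 : (‖(1:ℝ) - -1‖₊ / 2) ^ 2 = 1 := by
      ext; push_cast; norm_num
    rwa [e1, e2] at h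
  have := ProbabilityTheory.HasSubgaussianMGF.measure_sum_ge_le_of_iIndepFun hind hsub
    (ε := t * Fintype.card ι) (by positivity)
  rw [measureReal_def] at this
  refine (ENNReal.le_ofReal_iff_toReal_le (measure_ne_top _ _) (Real.exp_nonneg _)).mpr
    (this.trans_eq ?_)
  congr 1
  simp only [Finset.sum_const, Finset.card_univ, nsmul_eq_mul]
  push_cast
  rcases eq_or_ne (Fintype.card ι : ℝ) 0 with h | h
  · simp [h]
  · field_simp

theorem prod_measure_le_of_fiber_le {Ω Ω' : Type*} [MeasurableSpace Ω] [MeasurableSpace Ω']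
    (μ : Measure Ω) (ν : Measure Ω') [IsProbabilityMeasure μ] [IsProbabilityMeasure ν]
    {B : Set (Ω × Ω')} (hB : MeasurableSet B) (c : ℝ≥0∞) (h : ∀ y, ν (Prod.mk y ⁻¹' B) ≤ c) :
    (μ.prod ν) B ≤ c := by
  rw [Measure.prod_apply hB]
  refine (lintegral_mono h).trans ?_
  simp

/-- Hoeffding's inequality for a function that depends on a few of the sample points. -/
theorem pi_measure_hoeffding_dependent_le {κ α : Type*} [Fintype κ] [DecidableEq κ]
    [Finite α] [MeasurableSpace α] [DiscreteMeasurableSpace α] (ν : Measure α)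
    [IsProbabilityMeasure ν]
    (A : Finset κ) (q : ℕ) (hA : A.card ≤ q) (G : (κ → α) → α → ℝ)
    (hG : ∀ x y, (∀ i ∈ A, x i = y i) → G x = G y) (hb : ∀ x a, G x a ∈ Set.Icc (-1:ℝ) 1)
    (t : ℝ) (ht : 0 ≤ t) :
    Measure.pi (fun _ : κ => ν)
      {x | t * Fintype.card κ + 2 * q ≤ ∑ i, (G x (x i) - ∫ a, G x a ∂ν)}
      ≤ ENNReal.ofReal (Real.exp (-((Fintype.card κ - q) * t ^ 2 / 2))) := by
  classical
  obtain ⟨a₀⟩ : Nonempty α := ν.nonempty_of_neZero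
  have he := measurePreserving_piEquivPiSubtypeProd (fun _ : κ => ν) (fun i => i ∈ A)
  set e := MeasurableEquiv.piEquivPiSubtypeProd (fun _ : κ => α) (fun i => i ∈ A)
  let G' : ({i // i ∈ A} → α) → α → ℝ := fun y => G (e.symm (y, fun _ => a₀))
  have hG' : ∀ x, G x = G' (e x).1 := by
    intro x
    refine hG _ _ fun i hi => ?_
    simp [e, MeasurableEquiv.piEquivPiSubtypeProd, Equiv.piEquivPiSubtypeProd, hi]
  have hGm : ∀ x, |∫ a, G x a ∂ν| ≤ 1 := by
    intro x
    have := norm_integral_le_of_norm_le_const (μ := ν) (f := G x) (C := 1)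
      (ae_of_all _ fun a => abs_le.mpr (hb x a))
    simpa using this
  have hcard : (Fintype.card {i // i ∉ A} : ℝ) = Fintype.card κ - A.card := by
    rw [Fintype.card_subtype_compl, Fintype.card_coe, Nat.cast_sub (Finset.card_le_univ A)]
  have hA' : (A.card : ℝ) ≤ q := by exact_mod_cast hA
  let B' : Set (({i // i ∈ A} → α) × ({i // i ∉ A} → α)) :=
    {yz | t * Fintype.card {i // i ∉ A} ≤ ∑ i, (G' yz.1 (yz.2 i) - ∫ a, G' yz.1 a ∂ν)}
  have hsub : {x | t * Fintype.card κ + 2 * q ≤ ∑ i, (G x (x i) - ∫ a, G x a ∂ν)} ⊆ e ⁻¹' B' := by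
    intro x hx
    simp only [Set.mem_ofPred_eq] at hx
    simp only [Set.mem_preimage, B', Set.mem_ofPred_eq, ← hG', hcard]
    have h1 : ∑ i, (G x (x i) - ∫ a, G x a ∂ν)
        = ∑ i ∈ A, (G x (x i) - ∫ a, G x a ∂ν)
          + ∑ i : {i // i ∉ A}, (G x ((e x).2 i) - ∫ a, G x a ∂ν) := by
      rw [← Fintype.sum_subtype_add_sum_subtype (fun i => i ∈ A)]
      congr 1
      exact (Finset.sum_subtype A (fun _ => Iff.rfl) fun i => G x (x i) - ∫ a, G x a ∂ν).symm
    have h2 : ∑ i ∈ A, (G x (x i) - ∫ a, G x a ∂ν) ≤ ∑ i ∈ A, (2:ℝ) := by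
      refine Finset.sum_le_sum fun i _ => ?_
      have := (abs_le.mp (hGm x)).1
      linarith [(hb x (x i)).2]
    rw [Finset.sum_const, nsmul_eq_mul] at h2
    have : 0 ≤ t * (A.card : ℝ) := mul_nonneg ht (Nat.cast_nonneg _)
    nlinarith
  refine (measure_mono hsub).trans ?_
  rw [he.measure_preimage (MeasurableSet.of_discrete).nullMeasurableSet]
  refine prod_measure_le_of_fiber_le _ _ MeasurableSet.of_discrete _ fun y => ?_
  refine (pi_measure_hoeffding_le (fun _ : {i // i ∉ A} => ν) (fun _ => G' y)
    (fun _ => Measurable.of_discrete) (fun _ a => hb _ a) t ht).trans ?_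
  refine ENNReal.ofReal_le_ofReal (Real.exp_le_exp.mpr ?_)
  rw [hcard]
  have := sq_nonneg t
  nlinarith

/-- The average of the rows of `V` selected by a tuple of sample points and flags. -/
noncomputable def tupleRow {κ α : Type*} {q : ℕ} (V : α → α → ℝ) (w : Fin q → κ × Bool)
    (x : κ → α) (b : α) : ℝ :=
  (∑ l, (if (w l).2 then 1 else 0) * V (x (w l).1) b) / q

/-- The normalized sum of the columns of `V` on which `tupleRow` is positive. -/
noncomputable def tupleColumn {κ α : Type*} [Fintype α] {q : ℕ} (V : α → α → ℝ)
    (w : Fin q → κ × Bool) (x : κ → α) (a : α) : ℝ :=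
  (∑ b, if 0 < tupleRow V w x b then V a b else 0) / Fintype.card α

theorem abs_tupleRow_le {κ α : Type*} {q : ℕ} (V : α → α → ℝ) (hV : ∀ a b, |V a b| ≤ 1)
    (w : Fin q → κ × Bool) (x : κ → α) (b : α) : |tupleRow V w x b| ≤ 1 := by
  unfold tupleRow
  rw [abs_div, Nat.abs_cast]
  refine div_le_one_of_le₀ ?_ (Nat.cast_nonneg q)
  refine (Finset.abs_sum_le_sum_abs _ _).trans ?_
  calc ∑ l, |(if (w l).2 then (1:ℝ) else 0) * V (x (w l).1) b| ≤ ∑ _l : Fin q, (1:ℝ) := by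
        refine Finset.sum_le_sum fun l _ => ?_
        split_ifs
        · simpa using hV _ _
        · simp
    _ = q := by simp

theorem abs_tupleColumn_le {κ α : Type*} [Fintype α] {q : ℕ} (V : α → α → ℝ)
    (hV : ∀ a b, |V a b| ≤ 1) (w : Fin q → κ × Bool) (x : κ → α) (a : α) :
    |tupleColumn V w x a| ≤ 1 := by
  unfold tupleColumn
  rw [abs_div, Nat.abs_cast]
  refine div_le_one_of_le₀ ?_ (Nat.cast_nonneg _)
  refine (Finset.abs_sum_le_sum_abs _ _).trans ?_
  calc ∑ b, |if 0 < tupleRow V w x b then V a b else 0| ≤ ∑ _b : α, (1:ℝ) := by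
        refine Finset.sum_le_sum fun b _ => ?_
        split_ifs
        · exact hV _ _
        · simp
    _ = Fintype.card α := by simp

/-- If the empirical means of the finitely many functions built from tuples of sample points are
close to their expectations, then the cut norm of the sampled matrix is controlled by the cut norm
of the matrix. -/
theorem sum_sample_le_of_tuple_deviation {κ α : Type*} [Fintype κ] [Nonempty κ] [Fintype α]
    [Nonempty α]
    (V : α → α → ℝ) (hV : ∀ a b, |V a b| ≤ 1) (ε : ℝ)
    (hcut : ∀ S T : Finset α, ∑ a ∈ S, ∑ b ∈ T, V a b ≤ ε * (Fintype.card α : ℝ) ^ 2)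
    (q : ℕ) (hq : 0 < q) (δ : ℝ) (x : κ → α)
    (h1 : ∀ w : Fin q → κ × Bool, ∑ i, (max 0 (tupleRow V w x (x i))
      - (∑ b, max 0 (tupleRow V w x b)) / Fintype.card α) ≤ δ)
    (h2 : ∀ w : Fin q → κ × Bool, ∑ i, (max 0 (tupleColumn V w x (x i))
      - (∑ b, max 0 (tupleColumn V w x b)) / Fintype.card α) ≤ δ)
    (S T : Finset κ) :
    ∑ i ∈ S, ∑ j ∈ T, V (x i) (x j)
      ≤ (Fintype.card κ : ℝ) ^ 2 * (ε + 4 / √q) + 2 * (Fintype.card κ) * δ := by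
  classical
  have hk : (0:ℝ) < Fintype.card κ := by exact_mod_cast Fintype.card_pos
  have hN : (0:ℝ) < Fintype.card α := by exact_mod_cast Fintype.card_pos
  set k : ℝ := (Fintype.card κ : ℝ) with hkdef
  set N : ℝ := (Fintype.card α : ℝ) with hNdef
  let pt : κ ⊕ α → α := Sum.elim x id
  let ρ : κ ⊕ α → ℝ := Sum.elim (fun _ => 1 / k) (fun _ => 1 / N)
  obtain ⟨w₀, hw₀⟩ := exists_tuple_average_close ρ
    (by rintro (_ | _) <;> simp only [ρ, Sum.elim_inl, Sum.elim_inr] <;> positivity)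
    (fun i b => (if i ∈ S then 1 else 0) * V (x i) (pt b))
    (by
        intro i b
        split_ifs
        · simpa using hV _ _
        · simp) q hq
  let w : Fin q → κ × Bool := fun l => (w₀ l, decide (w₀ l ∈ S))
  have hH : ∀ b, (∑ l, (if w₀ l ∈ S then 1 else 0) * V (x (w₀ l)) b) / q = tupleRow V w x b := by
    intro b
    simp [tupleRow, w]
  let D : α → ℝ := fun b => (∑ i ∈ S, V (x i) b) / k - tupleRow V w x b
  have hD : (∑ j, |D (x j)|) / k + (∑ b, |D b|) / N ≤ 4 / √q := by
    have e1 : ∑ b, ρ b = 2 := by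
      simp only [Fintype.sum_sum_type, ρ, Sum.elim_inl, Sum.elim_inr, Finset.sum_const,
        Finset.card_univ, nsmul_eq_mul, ← hkdef, ← hNdef]
      field_simp
      norm_num
    rw [e1] at hw₀
    simp only [Fintype.sum_sum_type, ρ, pt, Sum.elim_inl, Sum.elim_inr, id, ← Finset.mul_sum,
      hH] at hw₀
    have e2 : ∀ b, ∑ i, (if i ∈ S then (1:ℝ) else 0) * V (x i) b = ∑ i ∈ S, V (x i) b := by
      intro b
      simp [ite_mul, Finset.sum_ite_mem]
    simp only [e2] at hw₀
    calc _ = _ := by rw [div_eq_inv_mul, div_eq_inv_mul, ← one_div, ← one_div]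
      _ ≤ _ := hw₀
      _ = _ := by norm_num
  have hmean : ∀ f : α → ℝ, ∑ i : κ, (f (x i) - (∑ b, f b) / N) ≤ δ →
      ∑ i, f (x i) ≤ k * ((∑ b, f b) / N) + δ := by
    intro f hf
    rw [Finset.sum_sub_distrib, Finset.sum_const, Finset.card_univ, nsmul_eq_mul] at hf
    linarith
  have s1 : ∑ i ∈ S, ∑ j ∈ T, V (x i) (x j)
      ≤ k * (∑ j, max 0 (tupleRow V w x (x j)) + ∑ j, |D (x j)|) := by
    rw [Finset.sum_comm, ← Finset.sum_add_distrib, Finset.mul_sum]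
    refine (Finset.sum_le_sum_of_subset_of_nonneg (Finset.subset_univ T) ?_).trans'
      (Finset.sum_le_sum fun j _ => ?_)
    · intro j _ _
      positivity
    · have : ∑ i ∈ S, V (x i) (x j) = k * (tupleRow V w x (x j) + D (x j)) := by
        simp only [D]; field_simp; ring
      rw [this]
      gcongr
      · exact le_max_right _ _
      · exact le_abs_self _
  have s2 := hmean (fun b => max 0 (tupleRow V w x b)) (h1 w)
  have s3 : (∑ b, max 0 (tupleRow V w x b)) / N
      ≤ (∑ i, max 0 (tupleColumn V w x (x i))) / k + (∑ b, |D b|) / N := by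
    have e1 : ∑ b, max 0 (tupleRow V w x b)
        ≤ ∑ b, ((∑ i ∈ S, if 0 < tupleRow V w x b then V (x i) b else 0) / k + |D b|) := by
      refine Finset.sum_le_sum fun b _ => ?_
      split_ifs with h
      · rw [max_eq_right h.le]
        have := neg_abs_le (D b)
        simp only [D] at this ⊢
        linarith
      · rw [max_eq_left (not_lt.mp h)]
        simp
    have e2 : ∑ i ∈ S, tupleColumn V w x (x i) ≤ ∑ i, max 0 (tupleColumn V w x (x i)) :=
      (Finset.sum_le_sum fun i _ => le_max_right 0 _).trans
        (Finset.sum_le_sum_of_subset_of_nonneg (Finset.subset_univ S)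
          fun i _ _ => le_max_left _ _)
    rw [Finset.sum_add_distrib, ← Finset.sum_div, Finset.sum_comm] at e1
    calc (∑ b, max 0 (tupleRow V w x b)) / N
        ≤ ((∑ i ∈ S, ∑ b, if 0 < tupleRow V w x b then V (x i) b else 0) / k
          + ∑ b, |D b|) / N := by gcongr
      _ = (∑ i ∈ S, tupleColumn V w x (x i)) / k + (∑ b, |D b|) / N := by
          simp only [tupleColumn, ← Finset.sum_div, ← hNdef]
          field_simp
      _ ≤ _ := by gcongr
  have s4 := hmean (fun b => max 0 (tupleColumn V w x b)) (h2 w)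
  have s5 : (∑ a, max 0 (tupleColumn V w x a)) / N ≤ ε := by
    have := hcut (Finset.univ.filter fun a => 0 < tupleColumn V w x a)
      (Finset.univ.filter fun b => 0 < tupleRow V w x b)
    have e1 : ∑ a, max 0 (tupleColumn V w x a)
        = (∑ a with 0 < tupleColumn V w x a, ∑ b with 0 < tupleRow V w x b, V a b) / N := by
      rw [Finset.sum_div, Finset.sum_filter]
      refine Finset.sum_congr rfl fun a _ => ?_
      split_ifs with h
      · rw [max_eq_right h.le, tupleColumn, Finset.sum_filter]
      · rw [max_eq_left (not_lt.mp h)]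
    rw [e1, div_div, div_le_iff₀ (by positivity)]
    linarith
  have hD' : ∑ j, |D (x j)| + k * ((∑ b, |D b|) / N) ≤ k * (4 / √q) := by
    calc _ = k * ((∑ j, |D (x j)|) / k + (∑ b, |D b|) / N) := by field_simp
      _ ≤ _ := by gcongr
  have s3' : k * ((∑ b, max 0 (tupleRow V w x b)) / N)
      ≤ ∑ i, max 0 (tupleColumn V w x (x i)) + k * ((∑ b, |D b|) / N) := by
    calc _ ≤ k * ((∑ i, max 0 (tupleColumn V w x (x i))) / k + (∑ b, |D b|) / N) := by gcongr
      _ = _ := by field_simp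
  have s5' : k * ((∑ a, max 0 (tupleColumn V w x a)) / N) ≤ k * ε := by gcongr
  calc _ ≤ _ := s1
    _ ≤ k * (k * ε + 2 * δ + k * (4 / √q)) :=
        mul_le_mul_of_nonneg_left (by linarith) hk.le
    _ = _ := by ring

/-- First sampling lemma (one-sided): with high probability the cut norm of the sampled matrix is
controlled by the cut norm of the matrix. -/
theorem pi_measure_exists_sum_sample_gt_le {κ α : Type*} [Fintype κ] [Nonempty κ] [Fintype α]
    [MeasurableSpace α] [DiscreteMeasurableSpace α] (ν : Measure α) [IsProbabilityMeasure ν]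
    (hν : ∀ f : α → ℝ, ∫ a, f a ∂ν = (∑ a, f a) / Fintype.card α)
    (V : α → α → ℝ) (hV : ∀ a b, |V a b| ≤ 1) (ε : ℝ)
    (hcut : ∀ S T : Finset α, ∑ a ∈ S, ∑ b ∈ T, V a b ≤ ε * (Fintype.card α : ℝ) ^ 2)
    (q : ℕ) (hq : 0 < q) (t : ℝ) (ht : 0 ≤ t) :
    Measure.pi (fun _ : κ => ν) {x | ∃ S T : Finset κ,
      (Fintype.card κ : ℝ) ^ 2 * (ε + 4 / √q) + 2 * Fintype.card κ * (t * Fintype.card κ + 2 * q)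
        < ∑ i ∈ S, ∑ j ∈ T, V (x i) (x j)}
      ≤ 2 * (2 * Fintype.card κ) ^ q *
        ENNReal.ofReal (Real.exp (-((Fintype.card κ - q) * t ^ 2 / 2))) := by
  classical
  have : Nonempty α := ν.nonempty_of_neZero
  set P := Measure.pi (fun _ : κ => ν)
  set δ : ℝ := t * Fintype.card κ + 2 * q
  set E := ENNReal.ofReal (Real.exp (-((Fintype.card κ - q) * t ^ 2 / 2)))
  have hpos : ∀ y : ℝ, |y| ≤ 1 → max 0 y ∈ Set.Icc (-1:ℝ) 1 := fun y hy =>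
    ⟨by linarith [le_max_left 0 y], max_le zero_le_one (abs_le.mp hy).2⟩
  have hrow : ∀ (w : Fin q → κ × Bool) (x y : κ → α),
      (∀ i ∈ Finset.univ.image (fun l => (w l).1), x i = y i) → tupleRow V w x = tupleRow V w y := by
    intro w x y h
    funext b
    unfold tupleRow
    congr 1
    refine Finset.sum_congr rfl fun l _ => ?_
    rw [h _ (Finset.mem_image_of_mem _ (Finset.mem_univ l))]
  have hcol : ∀ (w : Fin q → κ × Bool) (x y : κ → α),
      (∀ i ∈ Finset.univ.image (fun l => (w l).1), x i = y i) →
        tupleColumn V w x = tupleColumn V w y := by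
    intro w x y h
    funext a
    unfold tupleColumn
    rw [hrow w x y h]
  have hcardA : ∀ w : Fin q → κ × Bool, (Finset.univ.image (fun l => (w l).1)).card ≤ q :=
    fun w => Finset.card_image_le.trans (by simp)
  let B1 : (Fin q → κ × Bool) → Set (κ → α) := fun w =>
    {x | δ ≤ ∑ i, (max 0 (tupleRow V w x (x i)) - ∫ a, max 0 (tupleRow V w x a) ∂ν)}
  let B2 : (Fin q → κ × Bool) → Set (κ → α) := fun w =>
    {x | δ ≤ ∑ i, (max 0 (tupleColumn V w x (x i)) - ∫ a, max 0 (tupleColumn V w x a) ∂ν)}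
  have hB1 : ∀ w, P (B1 w) ≤ E := fun w =>
    pi_measure_hoeffding_dependent_le ν _ q (hcardA w) (fun x a => max 0 (tupleRow V w x a))
      (fun x y h => by simp only [hrow w x y h]) (fun x a => hpos _ (abs_tupleRow_le V hV w x a)) t ht
  have hB2 : ∀ w, P (B2 w) ≤ E := fun w =>
    pi_measure_hoeffding_dependent_le ν _ q (hcardA w) (fun x a => max 0 (tupleColumn V w x a))
      (fun x y h => by simp only [hcol w x y h])
      (fun x a => hpos _ (abs_tupleColumn_le V hV w x a)) t ht
  have hsub : {x | ∃ S T : Finset κ,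
      (Fintype.card κ : ℝ) ^ 2 * (ε + 4 / √q) + 2 * Fintype.card κ * δ
        < ∑ i ∈ S, ∑ j ∈ T, V (x i) (x j)} ⊆ ⋃ w, (B1 w ∪ B2 w) := by
    rintro x ⟨S, T, hx⟩
    by_contra hcon
    simp only [Set.mem_iUnion, Set.mem_union, not_exists, not_or, B1, B2, Set.mem_ofPred_eq, not_le,
      hν] at hcon
    exact absurd hx (not_lt.mpr (sum_sample_le_of_tuple_deviation V hV ε hcut q hq δ x
      (fun w => (hcon w).1.le) (fun w => (hcon w).2.le) S T))
  refine (measure_mono hsub).trans ?_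
  refine (measure_iUnion_fintype_le _ _).trans ?_
  calc ∑ w, P (B1 w ∪ B2 w) ≤ ∑ _w : Fin q → κ × Bool, (E + E) :=
        Finset.sum_le_sum fun w _ => (measure_union_le _ _).trans (add_le_add (hB1 w) (hB2 w))
    _ = _ := by
        simp only [Finset.sum_const, Finset.card_univ, Fintype.card_fun, Fintype.card_prod,
          Fintype.card_bool, Fintype.card_fin, nsmul_eq_mul]
        push_cast
        ring

theorem sum_comp_fiber_le {α κ : Type*} [Fintype α] [Fintype κ] [DecidableEq κ]
    (st : α → κ) (m : ℕ)
    (hst : ∀ i, (Finset.univ.filter fun a => st a = i).card = m) (B : κ → κ → ℝ) (K : ℝ)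
    (hB : ∀ S T : Finset κ, ∑ i ∈ S, ∑ j ∈ T, B i j ≤ K) (S T : Finset α) :
    ∑ a ∈ S, ∑ b ∈ T, B (st a) (st b) ≤ (m:ℝ) ^ 2 * K := by
  classical
  have hK : 0 ≤ K := by simpa using hB ∅ ∅
  have hcard : ∀ (S : Finset α) i, (S.filter fun a => st a = i).card ≤ m := fun S i => by
    rw [← hst i]
    exact Finset.card_le_card (Finset.filter_subset_filter _ (Finset.subset_univ _))
  rcases Nat.eq_zero_or_pos m with rfl | hm
  · have hS : S = ∅ := by
      refine Finset.eq_empty_of_forall_notMem fun a ha => ?_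
      have h0 : 0 < (S.filter fun b => st b = st a).card :=
        Finset.card_pos.2 ⟨a, Finset.mem_filter.2 ⟨ha, rfl⟩⟩
      exact absurd (hcard S (st a)) (by omega)
    simp [hS]
  have hm' : (0:ℝ) < m := by exact_mod_cast hm
  have hw : ∀ (S : Finset α) i, ((S.filter fun a => st a = i).card : ℝ) / m ∈ Set.Icc (0:ℝ) 1 :=
    fun S i => ⟨by positivity, div_le_one_of_le₀ (by exact_mod_cast hcard S i) hm'.le⟩
  have key := sum_weight_mul_weight_le B K hB _ _ (hw S) (hw T)
  have hfib : ∀ (S : Finset α) (f : κ → ℝ),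
      ∑ a ∈ S, f (st a) = ∑ i, ((S.filter fun a => st a = i).card : ℝ) * f i := by
    intro S f
    rw [← Finset.sum_fiberwise S st]
    refine Finset.sum_congr rfl fun i _ => ?_
    rw [Finset.sum_congr rfl (g := fun _ => f i)]
    · simp
    · intro a ha
      rw [(Finset.mem_filter.1 ha).2]
  calc ∑ a ∈ S, ∑ b ∈ T, B (st a) (st b)
      = (m:ℝ) ^ 2 * ∑ i, ∑ j, ((S.filter fun a => st a = i).card : ℝ) / m *
          (((T.filter fun a => st a = j).card : ℝ) / m) * B i j := by
        simp_rw [fun a => hfib T (B (st a))]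
        rw [hfib S fun i => ∑ j, ((T.filter fun a => st a = j).card : ℝ) * B i j, Finset.mul_sum]
        refine Finset.sum_congr rfl fun i _ => ?_
        rw [Finset.mul_sum, Finset.mul_sum]
        refine Finset.sum_congr rfl fun j _ => ?_
        field_simp
    _ ≤ _ := by gcongr

/-- Comparison of a blown-up sampled matrix with a relabeled matrix that has a weak regularity
approximation by the step matrix `w`. -/
theorem sum_step_sub_perm_le {α κ L : Type*} [Fintype α] [Fintype κ] [DecidableEq κ]
    [DecidableEq L] (st : α → κ) (m : ℕ)
    (hst : ∀ i, (Finset.univ.filter fun a => st a = i).card = m)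
    (y : κ → α) (p : α → L) (π : Equiv.Perm α) (δ δ' ε : ℝ)
    (hπ : ((Finset.univ.filter fun a => p (y (st a)) ≠ p (π a)).card : ℝ) ≤ δ' * Fintype.card α)
    (u : κ → κ → ℝ) (M : α → α → ℝ) (w : L → L → ℝ)
    (hw : ∀ l₁ l₂ l₃ l₄, w l₁ l₂ - w l₃ l₄ ≤ 1)
    (hu : ∀ S T : Finset κ, ∑ i ∈ S, ∑ j ∈ T, (u i j - w (p (y i)) (p (y j)))
      ≤ δ * (Fintype.card κ : ℝ) ^ 2)
    (hM : ∀ S T : Finset α, ∑ a ∈ S, ∑ b ∈ T, (w (p a) (p b) - M a b)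
      ≤ ε * (Fintype.card α : ℝ) ^ 2) (S T : Finset α) :
    ∑ a ∈ S, ∑ b ∈ T, (u (st a) (st b) - M (π a) (π b))
      ≤ (δ + 2 * δ' + ε) * (Fintype.card α : ℝ) ^ 2 := by
  classical
  have hcard : (Fintype.card α : ℝ) = m * Fintype.card κ := by
    have := Finset.card_eq_sum_card_fiberwise (s := (Finset.univ : Finset α))
      (t := (Finset.univ : Finset κ)) (f := st) (fun _ _ => Finset.mem_coe.2 (Finset.mem_univ _))
    simp only [hst, Finset.sum_const, Finset.card_univ, smul_eq_mul] at this
    rw [this]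
    push_cast
    ring
  have h1 := sum_comp_fiber_le st m hst _ _ hu S T
  have h3 := hM (S.map π.toEmbedding) (T.map π.toEmbedding)
  simp only [Finset.sum_map, Equiv.coe_toEmbedding] at h3
  set D : α → ℝ := fun a => if p (y (st a)) ≠ p (π a) then 1 else 0 with hD
  have hD0 : ∀ a, 0 ≤ D a := fun a => by
    simp only [hD]
    split_ifs <;> norm_num
  have hDs : ∀ S : Finset α, ∑ a ∈ S, D a ≤ δ' * Fintype.card α := fun S => by
    refine le_trans (Finset.sum_le_univ_sum_of_nonneg hD0) (le_trans (le_of_eq ?_) hπ)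
    simp only [hD]
    rw [Finset.sum_boole]
  have h2 : ∑ a ∈ S, ∑ b ∈ T, (w (p (y (st a))) (p (y (st b))) - w (p (π a)) (p (π b)))
      ≤ 2 * δ' * (Fintype.card α : ℝ) ^ 2 := by
    have hc : ∀ S : Finset α, (S.card : ℝ) ≤ Fintype.card α := fun S => by
      exact_mod_cast S.card_le_univ
    have hδ : 0 ≤ δ' * Fintype.card α := le_trans (Nat.cast_nonneg _) hπ
    calc _ ≤ ∑ a ∈ S, ∑ b ∈ T, (D a + D b) := by
          refine Finset.sum_le_sum fun a _ => Finset.sum_le_sum fun b _ => ?_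
          by_cases ha : p (y (st a)) = p (π a)
          · by_cases hb : p (y (st b)) = p (π b)
            · rw [ha, hb, sub_self]
              exact add_nonneg (hD0 a) (hD0 b)
            · have : D b = 1 := if_pos hb
              linarith [hD0 a, hw (p (y (st a))) (p (y (st b))) (p (π a)) (p (π b))]
          · have : D a = 1 := if_pos ha
            linarith [hD0 b, hw (p (y (st a))) (p (y (st b))) (p (π a)) (p (π b))]
      _ = T.card * ∑ a ∈ S, D a + S.card * ∑ b ∈ T, D b := by
          simp [Finset.sum_add_distrib, Finset.mul_sum]
      _ ≤ Fintype.card α * (δ' * Fintype.card α) + Fintype.card α * (δ' * Fintype.card α) :=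
          add_le_add
            (mul_le_mul (hc T) (hDs S) (Finset.sum_nonneg fun a _ => hD0 a) (Nat.cast_nonneg _))
            (mul_le_mul (hc S) (hDs T) (Finset.sum_nonneg fun a _ => hD0 a) (Nat.cast_nonneg _))
      _ = _ := by ring
  have hsplit : ∑ a ∈ S, ∑ b ∈ T, (u (st a) (st b) - M (π a) (π b))
      = ∑ a ∈ S, ∑ b ∈ T, (u (st a) (st b) - w (p (y (st a))) (p (y (st b))))
        + ∑ a ∈ S, ∑ b ∈ T, (w (p (y (st a))) (p (y (st b))) - w (p (π a)) (p (π b)))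
        + ∑ a ∈ S, ∑ b ∈ T, (w (p (π a)) (p (π b)) - M (π a) (π b)) := by
    simp only [← Finset.sum_add_distrib]
    refine Finset.sum_congr rfl fun a _ => Finset.sum_congr rfl fun b _ => ?_
    ring
  rw [hsplit]
  have h1' : (m:ℝ) ^ 2 * (δ * (Fintype.card κ : ℝ) ^ 2) = δ * (Fintype.card α : ℝ) ^ 2 := by
    rw [hcard]
    ring
  rw [h1'] at h1
  linarith

theorem exists_perm_sum_step_sub_le {α κ ι : Type*} [Fintype α] [Fintype κ] [Fintype ι]
    [DecidableEq α] [DecidableEq κ] (c : ι → ℝ) (hc0 : ∀ n, 0 ≤ c n) (hc1 : ∑ n, c n ≤ 1)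
    (st : α → κ) (m : ℕ) (hst : ∀ i, (Finset.univ.filter fun a => st a = i).card = m)
    (hα : Fintype.card α = m * Fintype.card κ) (hα0 : 0 < Fintype.card α)
    (y : κ → α) (p : α → ℕ) (δ' ε : ℝ)
    (hy : ∀ A : Finset ℕ, ((Finset.univ.filter fun i => p (y i) ∈ A).card : ℝ)
      ≤ Fintype.card κ *
        (((Finset.univ.filter fun a => p a ∈ A).card : ℝ) / Fintype.card α + δ'))
    (M : ι → α → α → ℝ) (w : ι → ℕ → ℕ → ℝ) (hw : ∀ n l₁ l₂, w n l₁ l₂ ∈ Set.Icc (0:ℝ) 1)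
    (hM : ∀ S T : Finset α, ∑ n, c n * |∑ a ∈ S, ∑ b ∈ T, (M n a b - w n (p a) (p b))|
      ≤ ε * (Fintype.card α : ℝ) ^ 2) :
    ∃ π : Equiv.Perm α, ∀ (u : ι → κ → κ → ℝ) (δ : ℝ),
      (∀ (σ : ι → ℤˣ) (S T : Finset κ), ∑ i ∈ S, ∑ j ∈ T,
        ∑ n, c n * ((σ n : ℤ) : ℝ) * (u n i j - w n (p (y i)) (p (y j)))
          ≤ δ * (Fintype.card κ : ℝ) ^ 2) →
      ∀ (σ : ι → ℤˣ) (S T : Finset α), ∑ a ∈ S, ∑ b ∈ T,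
        ∑ n, c n * ((σ n : ℤ) : ℝ) * (u n (st a) (st b) - M n (π a) (π b))
          ≤ (δ + 2 * δ' + ε) * (Fintype.card α : ℝ) ^ 2 := by
  have hσ : ∀ s : ℤˣ, |((s : ℤ) : ℝ)| = 1 := fun s => by
    rcases Int.units_eq_one_or s with rfl | rfl <;> simp
  obtain ⟨π, A, hA⟩ := exists_perm_card_ne_le (fun a => p (y (st a))) p
  have hcount : (Finset.univ.filter fun a => p (y (st a)) ∈ A).card
      = m * (Finset.univ.filter fun i => p (y i) ∈ A).card := by
    rw [Finset.card_eq_sum_card_fiberwise (f := st)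
      (t := Finset.univ.filter fun i => p (y i) ∈ A) (fun a ha => by simpa using ha)]
    rw [Finset.sum_congr rfl (g := fun _ => m), Finset.sum_const, smul_eq_mul, mul_comm]
    intro i hi
    rw [← hst i, Finset.filter_filter]
    congr 1
    ext a
    simp only [Finset.mem_filter, Finset.mem_univ, true_and] at hi ⊢
    exact ⟨fun h => h.2, fun h => ⟨h ▸ hi, h⟩⟩
  have hα' : (Fintype.card α : ℝ) = m * Fintype.card κ := by exact_mod_cast hα
  have hα0' : (0:ℝ) < Fintype.card α := by exact_mod_cast hα0
  have hπ : ((Finset.univ.filter fun a => p (y (st a)) ≠ p (π a)).card : ℝ)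
      ≤ δ' * Fintype.card α := by
    have h1 : ((Finset.univ.filter fun a => p (y (st a)) ≠ p (π a)).card : ℝ)
        + (Finset.univ.filter fun a => p a ∈ A).card
        = m * (Finset.univ.filter fun i => p (y i) ∈ A).card := by
      rw [hcount] at hA
      exact_mod_cast hA
    have h2 := mul_le_mul_of_nonneg_left (hy A) (Nat.cast_nonneg (α := ℝ) m)
    have h3 : (m:ℝ) * (Fintype.card κ *
        (((Finset.univ.filter fun a => p a ∈ A).card : ℝ) / Fintype.card α + δ'))
        = (Finset.univ.filter fun a => p a ∈ A).card + δ' * Fintype.card α := by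
      rw [← mul_assoc, ← hα']
      field_simp
    linarith
  refine ⟨π, fun u δ hu σ S T => ?_⟩
  have key := sum_step_sub_perm_le st m hst y p π δ δ' ε hπ
    (fun i j => ∑ n, c n * ((σ n : ℤ) : ℝ) * u n i j)
    (fun a b => ∑ n, c n * ((σ n : ℤ) : ℝ) * M n a b)
    (fun l₁ l₂ => ∑ n, c n * ((σ n : ℤ) : ℝ) * w n l₁ l₂) ?_ ?_ ?_ S T
  · refine le_trans (le_of_eq ?_) key
    simp only [← Finset.sum_sub_distrib, mul_sub]
  · intro l₁ l₂ l₃ l₄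
    rw [← Finset.sum_sub_distrib]
    refine le_trans (Finset.sum_le_sum (g := c) fun n _ => ?_) hc1
    rw [← mul_sub, mul_assoc]
    refine mul_le_of_le_one_right (hc0 n) (le_trans (le_abs_self _) ?_)
    rw [abs_mul, hσ, one_mul, abs_le]
    have h1 := hw n l₁ l₂
    have h2 := hw n l₃ l₄
    constructor <;> linarith [h1.1, h1.2, h2.1, h2.2]
  · intro S T
    refine le_trans (le_of_eq ?_) (hu σ S T)
    simp only [← Finset.sum_sub_distrib, mul_sub]
  · intro S T
    refine le_trans ?_ (hM S T)
    have : ∑ a ∈ S, ∑ b ∈ T, (∑ n, c n * ((σ n : ℤ) : ℝ) * w n (p a) (p b)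
          - ∑ n, c n * ((σ n : ℤ) : ℝ) * M n a b)
        = ∑ n, c n * ((σ n : ℤ) : ℝ) * -(∑ a ∈ S, ∑ b ∈ T, (M n a b - w n (p a) (p b))) := by
      simp only [← Finset.sum_sub_distrib, ← mul_sub, ← Finset.sum_neg_distrib, neg_sub,
        Finset.mul_sum]
      exact (Finset.sum_congr rfl fun a _ => Finset.sum_comm).trans Finset.sum_comm
    rw [this]
    refine Finset.sum_le_sum fun n _ => ?_
    rw [mul_assoc]
    refine mul_le_mul_of_nonneg_left (le_trans (le_abs_self _) ?_) (hc0 n)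
    rw [abs_mul, hσ, one_mul, abs_neg]

/-- The index of the cell of the uniform partition of `[0,1]` into `N` intervals that contains a
point (the point `0` is put in the first cell). -/
def cellIdx (N : ℕ) [NeZero N] (t : unitInterval) : Fin N :=
  ⟨⌈(N:ℝ) * t⌉₊ - 1, by
    have h : ⌈(N:ℝ) * t⌉₊ ≤ N :=
      Nat.ceil_le.2 (mul_le_of_le_one_right (Nat.cast_nonneg N) t.2.2)
    have := NeZero.pos N
    omega⟩

theorem cellIdx_eq_iff {N : ℕ} [NeZero N] {t : unitInterval} (ht : (0:ℝ) < t) (a : Fin N) :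
    cellIdx N t = a ↔ t ∈ stepSet N a := by
  have hN : (0:ℝ) < N := by exact_mod_cast NeZero.pos N
  have hpos : 0 < ⌈(N:ℝ) * t⌉₊ := Nat.ceil_pos.2 (mul_pos hN ht)
  have h1 : cellIdx N t = a ↔ ⌈(N:ℝ) * t⌉₊ = a.val + 1 := by
    rw [Fin.ext_iff]
    change ⌈(N:ℝ) * t⌉₊ - 1 = a.val ↔ _
    omega
  rw [h1, Nat.ceil_eq_iff (by omega)]
  change _ ↔ ((a:ℕ):ℝ) / N < (t:ℝ) ∧ (t:ℝ) ≤ (((a:ℕ):ℝ) + 1) / N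
  rw [div_lt_iff₀ hN, le_div_iff₀ hN, Nat.add_sub_cancel, mul_comm (N:ℝ)]
  push_cast
  rfl

theorem mem_stepSet_cellIdx {N : ℕ} [NeZero N] {t : unitInterval} (ht : (0:ℝ) < t) :
    t ∈ stepSet N (cellIdx N t) := (cellIdx_eq_iff ht _).1 rfl

theorem measurable_cellIdx (N : ℕ) [NeZero N] : Measurable (cellIdx N) := by
  refine measurable_to_countable' fun a => ?_
  have : cellIdx N ⁻¹' {a} = (fun t : unitInterval => ⌈(N:ℝ) * t⌉₊) ⁻¹' {n | n - 1 = a.val} := by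
    ext t
    simp [cellIdx, Fin.ext_iff]
  rw [this]
  exact (Nat.measurable_ceil.comp (measurable_subtype_coe.const_mul (N:ℝ)))
    (MeasurableSet.of_discrete)

theorem ae_pos_unitInterval : ∀ᵐ t : unitInterval ∂volume, (0:ℝ) < t := by
  have : ∀ᵐ t : unitInterval ∂volume, t ≠ 0 := by
    simp [ae_iff]
  filter_upwards [this] with t ht
  exact unitInterval.pos_iff_ne_zero.2 ht

theorem measurableSet_stepSet (N : ℕ) (a : Fin N) : MeasurableSet (stepSet N a) :=
  (measurableSet_lt measurable_const measurable_subtype_coe).inter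
    (measurableSet_le measurable_subtype_coe measurable_const)

theorem volume_stepSet (N : ℕ) [NeZero N] (a : Fin N) :
    volume (stepSet N a) = ENNReal.ofReal (1 / N) := by
  have hN : (0:ℝ) < N := by exact_mod_cast NeZero.pos N
  have ha : ((a:ℕ):ℝ) + 1 ≤ N := by exact_mod_cast a.2
  let s : unitInterval := ⟨(a:ℕ) / N, by positivity, by rw [div_le_one hN]; linarith⟩
  let e : unitInterval := ⟨((a:ℕ) + 1) / N, by positivity, by rw [div_le_one hN]; linarith⟩
  have : stepSet N a = Set.Ioc s e := rfl
  rw [this, unitInterval.volume_Ioc]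
  congr 1
  simp only [s, e]
  ring

theorem cellIdx_preimage_ae_eq (N : ℕ) [NeZero N] (a : Fin N) :
    cellIdx N ⁻¹' {a} =ᵐ[volume] stepSet N a := by
  filter_upwards [ae_pos_unitInterval] with t ht
  exact propext (cellIdx_eq_iff ht a)

theorem volume_cellIdx_preimage (N : ℕ) [NeZero N] (a : Fin N) :
    volume (cellIdx N ⁻¹' {a}) = ENNReal.ofReal (1 / N) := by
  rw [measure_congr (cellIdx_preimage_ae_eq N a), volume_stepSet]

/-- The law of the cell index of a uniform point. -/
def cellLaw (N : ℕ) [NeZero N] : Measure (Fin N) := volume.map (cellIdx N)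

instance (N : ℕ) [NeZero N] : IsProbabilityMeasure (cellLaw N) :=
  Measure.isProbabilityMeasure_map (measurable_cellIdx N).aemeasurable

theorem integral_cellLaw (N : ℕ) [NeZero N] (f : Fin N → ℝ) :
    ∫ a, f a ∂(cellLaw N) = (∑ a, f a) / Fintype.card (Fin N) := by
  rw [integral_fintype (.of_finite), Finset.sum_div]
  refine Finset.sum_congr rfl fun a _ => ?_
  rw [Measure.real, cellLaw, Measure.map_apply (measurable_cellIdx N) (measurableSet_singleton a),
    volume_cellIdx_preimage, ENNReal.toReal_ofReal (by positivity)]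
  simp
  ring

theorem cellIdx_mul_div (k m : ℕ) [NeZero k] [NeZero (k * m)] (t : unitInterval) :
    (cellIdx (k * m) t).val / m = (cellIdx k t).val := by
  have hm : 0 < m := Nat.pos_of_mul_pos_left (NeZero.pos (k * m))
  have h1 : ⌈((k * m : ℕ) : ℝ) * t⌉₊ ≤ m * ⌈(k:ℝ) * t⌉₊ := by
    refine Nat.ceil_le.2 ?_
    have := mul_le_mul_of_nonneg_left (Nat.le_ceil ((k:ℝ) * t)) (Nat.cast_nonneg (α := ℝ) m)
    push_cast
    linarith
  change (⌈((k * m : ℕ) : ℝ) * t⌉₊ - 1) / m = ⌈(k:ℝ) * t⌉₊ - 1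
  rcases Nat.eq_zero_or_pos ⌈(k:ℝ) * t⌉₊ with h0 | h0
  · rw [h0] at h1 ⊢
    have : ⌈((k * m : ℕ) : ℝ) * t⌉₊ = 0 := by omega
    rw [this]
    simp
  · obtain ⟨j, hj⟩ : ∃ j, ⌈(k:ℝ) * t⌉₊ = j + 1 := ⟨_, (Nat.succ_pred_eq_of_pos h0).symm⟩
    have h2 : m * j < ⌈((k * m : ℕ) : ℝ) * t⌉₊ := by
      refine Nat.lt_ceil.2 ?_
      have h3 : (j:ℝ) < k * t := Nat.lt_ceil.1 (by omega)
      have := mul_lt_mul_of_pos_left h3 (show (0:ℝ) < m by exact_mod_cast hm)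
      push_cast
      linarith
    rw [hj] at h1 ⊢
    rw [Nat.add_sub_cancel]
    refine Nat.div_eq_of_lt_le ?_ ?_
    · rw [mul_comm]
      omega
    · have : m * (j + 1) = (j + 1) * m := mul_comm _ _
      omega

theorem sum_volume_inter_cellIdx (N : ℕ) [NeZero N] (B : Set unitInterval) :
    ∑ a, volume (B ∩ cellIdx N ⁻¹' {a}) = volume B := by
  have h := sum_measure_singleton (μ := (volume.restrict B).map (cellIdx N)) (s := Finset.univ)
  rw [Finset.coe_univ, Measure.map_apply (measurable_cellIdx N) MeasurableSet.univ,
    Set.preimage_univ, Measure.restrict_apply_univ] at h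
  rw [← h]
  refine Finset.sum_congr rfl fun a _ => ?_
  rw [Measure.map_apply (measurable_cellIdx N) (measurableSet_singleton a),
    Measure.restrict_apply (measurable_cellIdx N (measurableSet_singleton a)), Set.inter_comm]

/-- The interval exchange of `[0,1]` permuting the cells of the uniform partition. -/
def permMap (N : ℕ) [NeZero N] (π : Equiv.Perm (Fin N)) (t : unitInterval) : unitInterval :=
  if (0:ℝ) < t then
    Set.projIcc 0 1 zero_le_one
      ((t:ℝ) + (((π (cellIdx N t) : ℕ) : ℝ) - ((cellIdx N t : ℕ) : ℝ)) / N)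
  else 0

section permMap

variable {N : ℕ} [NeZero N] (π : Equiv.Perm (Fin N))

theorem coe_permMap {t : unitInterval} (ht : (0:ℝ) < t) :
    (permMap N π t : ℝ) = (t:ℝ) + (((π (cellIdx N t) : ℕ) : ℝ) - ((cellIdx N t : ℕ) : ℝ)) / N := by
  have hN : (0:ℝ) < N := by exact_mod_cast NeZero.pos N
  have h := mem_stepSet_cellIdx (N := N) ht
  have h1 : ((cellIdx N t : ℕ) : ℝ) / N < t := h.1
  have h2 : (t:ℝ) ≤ (((cellIdx N t : ℕ) : ℝ) + 1) / N := h.2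
  have h3 : ((π (cellIdx N t) : ℕ) : ℝ) + 1 ≤ N := by exact_mod_cast (π (cellIdx N t)).2
  have h4 : (((π (cellIdx N t) : ℕ) : ℝ) + 1) / N ≤ 1 := by rwa [div_le_one hN]
  have h5 : (0:ℝ) ≤ ((π (cellIdx N t) : ℕ) : ℝ) / N := by positivity
  rw [permMap, if_pos ht, Set.projIcc_of_mem]
  rw [add_div] at h2 h4
  rw [sub_div]
  constructor <;> linarith

theorem permMap_mem_stepSet {t : unitInterval} (ht : (0:ℝ) < t) :
    permMap N π t ∈ stepSet N (π (cellIdx N t)) := by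
  have h := mem_stepSet_cellIdx (N := N) ht
  have h1 : ((cellIdx N t : ℕ) : ℝ) / N < t := h.1
  have h2 : (t:ℝ) ≤ (((cellIdx N t : ℕ) : ℝ) + 1) / N := h.2
  change ((π (cellIdx N t) : ℕ) : ℝ) / N < (permMap N π t : ℝ) ∧
    (permMap N π t : ℝ) ≤ (((π (cellIdx N t) : ℕ) : ℝ) + 1) / N
  rw [coe_permMap π ht]
  rw [add_div] at h2 ⊢
  rw [sub_div]
  constructor <;> linarith

theorem permMap_pos {t : unitInterval} (ht : (0:ℝ) < t) : (0:ℝ) < permMap N π t :=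
  lt_of_le_of_lt (by positivity) (permMap_mem_stepSet π ht).1

theorem cellIdx_permMap {t : unitInterval} (ht : (0:ℝ) < t) :
    cellIdx N (permMap N π t) = π (cellIdx N t) :=
  (cellIdx_eq_iff (permMap_pos π ht) _).2 (permMap_mem_stepSet π ht)

theorem permMap_permMap {π ρ : Equiv.Perm (Fin N)} (h : ∀ a, ρ (π a) = a) (t : unitInterval) :
    permMap N ρ (permMap N π t) = t := by
  by_cases ht : (0:ℝ) < t
  · refine Subtype.ext ?_
    rw [coe_permMap ρ (permMap_pos π ht), cellIdx_permMap π ht, coe_permMap π ht, h]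
    ring
  · have h0 : t = 0 := by
      by_contra hne
      exact ht (unitInterval.pos_iff_ne_zero.2 hne)
    subst h0
    simp [permMap]

theorem bijective_permMap : Function.Bijective (permMap N π) :=
  Function.bijective_iff_has_inverse.2 ⟨permMap N π.symm,
    permMap_permMap fun a => π.symm_apply_apply a, permMap_permMap fun a => π.apply_symm_apply a⟩

theorem measurable_permMap : Measurable (permMap N π) := by
  have hc : ∀ f : Fin N → ℝ, Measurable fun t => f (cellIdx N t) := fun f =>
    (measurable_of_finite f).comp (measurable_cellIdx N)
  refine Measurable.ite (measurableSet_lt measurable_const measurable_subtype_coe) ?_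
    measurable_const
  exact continuous_projIcc.measurable.comp (measurable_subtype_coe.add
    (((hc fun a => ((π a : ℕ) : ℝ)).sub (hc fun a => ((a : ℕ) : ℝ))).div_const _))

theorem isMP_permMap : IsMP (permMap N π) := by
  refine ⟨measurable_permMap π, Measure.ext fun B hB => ?_⟩
  rw [Measure.map_apply (measurable_permMap π) hB,
    ← sum_volume_inter_cellIdx N, ← sum_volume_inter_cellIdx N B,
    ← Equiv.sum_comp π fun a => volume (B ∩ cellIdx N ⁻¹' {a})]
  refine Finset.sum_congr rfl fun a _ => ?_
  rw [measure_congr ((ae_eq_refl _).inter (cellIdx_preimage_ae_eq N a)),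
    measure_congr ((ae_eq_refl _).inter (cellIdx_preimage_ae_eq N (π a))),
    unitInterval.volume_apply, unitInterval.volume_apply,
    ← measure_preimage_add_right volume ((((π a : ℕ) : ℝ) - ((a : ℕ) : ℝ)) / N)
      (Subtype.val '' (B ∩ stepSet N (π a)))]
  congr 1
  ext s
  simp only [Set.mem_image, Set.mem_preimage, Set.mem_inter_iff]
  have hpos : ∀ {b : Fin N} {t : unitInterval}, t ∈ stepSet N b → (0:ℝ) < t := fun h =>
    lt_of_le_of_lt (by positivity) h.1
  constructor
  · rintro ⟨t, ⟨htB, hta⟩, rfl⟩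
    have ht := hpos hta
    have hc := (cellIdx_eq_iff ht a).2 hta
    refine ⟨permMap N π t, ⟨htB, hc ▸ permMap_mem_stepSet π ht⟩, ?_⟩
    rw [coe_permMap π ht, hc]
  · rintro ⟨t, ⟨htB, hta⟩, hts⟩
    have ht := hpos hta
    have hc := (cellIdx_eq_iff ht _).2 hta
    have hinv := permMap_permMap (π := π.symm) (ρ := π) (fun a => π.apply_symm_apply a) t
    have hc' : π.symm (cellIdx N t) = a := by rw [hc, Equiv.symm_apply_apply]
    refine ⟨permMap N π.symm t, ⟨by rwa [hinv], hc' ▸ permMap_mem_stepSet π.symm ht⟩, ?_⟩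
    rw [coe_permMap π.symm ht, hc', hc, hts]
    ring

end permMap

theorem setIntegral_cellIdx (N : ℕ) [NeZero N] (g : Fin N → Fin N → ℝ) (S T : Set unitInterval) :
    ∫ p in S ×ˢ T, g (cellIdx N p.1) (cellIdx N p.2) ∂(volume : Measure Sq)
      = ∑ a, ∑ b, volume.real (cellIdx N ⁻¹' {a} ∩ S) * volume.real (cellIdx N ⁻¹' {b} ∩ T)
        * g a b := by
  have hm := measurable_cellIdx N
  have h : ((volume : Measure Sq).restrict (S ×ˢ T)).map (Prod.map (cellIdx N) (cellIdx N))
      = ((volume.restrict S).map (cellIdx N)).prod ((volume.restrict T).map (cellIdx N)) := by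
    rw [Measure.volume_eq_prod, ← Measure.prod_restrict, Measure.map_prod_map _ _ hm hm]
  have := integral_map (μ := (volume : Measure Sq).restrict (S ×ˢ T)) (hm.prodMap hm).aemeasurable
    (f := fun q : Fin N × Fin N => g q.1 q.2) (measurable_of_finite _).aestronglyMeasurable
  rw [h] at this
  simp only [Prod.map_fst, Prod.map_snd] at this
  rw [← this, integral_fintype (.of_finite), Fintype.sum_prod_type]
  refine Finset.sum_congr rfl fun a _ => Finset.sum_congr rfl fun b _ => ?_
  rw [← Set.singleton_prod_singleton, measureReal_prod_prod,
    map_measureReal_apply hm (measurableSet_singleton a),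
    map_measureReal_apply hm (measurableSet_singleton b),
    measureReal_restrict_apply (hm (measurableSet_singleton a)),
    measureReal_restrict_apply (hm (measurableSet_singleton b)), smul_eq_mul]

/-- The right endpoint of a cell of the uniform partition. -/
def cellEnd {N : ℕ} (a : Fin N) : unitInterval :=
  ⟨((a : ℕ) + 1) / N, by positivity, by
    rw [div_le_one (by exact_mod_cast a.pos)]
    exact_mod_cast a.2⟩

theorem dist_cellEnd_cellIdx_le (N : ℕ) [NeZero N] {t : unitInterval} (ht : (0:ℝ) < t) :
    dist t (cellEnd (cellIdx N t)) ≤ 1 / N := by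
  have h := mem_stepSet_cellIdx (N := N) ht
  have h1 : ((cellIdx N t : ℕ) : ℝ) / N < t := h.1
  have h2 : (t:ℝ) ≤ (((cellIdx N t : ℕ) : ℝ) + 1) / N := h.2
  change |(t:ℝ) - (((cellIdx N t : ℕ) : ℝ) + 1) / N| ≤ _
  rw [abs_le]
  rw [add_div] at h2 ⊢
  constructor <;> linarith [show (0:ℝ) ≤ 1 / N by positivity]

theorem ae_pos_sq : ∀ᵐ p : Sq ∂volume, (0:ℝ) < p.1 ∧ (0:ℝ) < p.2 := by
  have h1 : ∀ᵐ p : Sq ∂volume, (0:ℝ) < p.1 :=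
    (Measure.quasiMeasurePreserving_fst (μ := (volume : Measure unitInterval))
      (ν := (volume : Measure unitInterval))).ae ae_pos_unitInterval
  have h2 : ∀ᵐ p : Sq ∂volume, (0:ℝ) < p.2 :=
    (Measure.quasiMeasurePreserving_snd (μ := (volume : Measure unitInterval))
      (ν := (volume : Measure unitInterval))).ae ae_pos_unitInterval
  exact h1.and h2

theorem abs_sub_max_min_le {x : ℝ} (hx : x ∈ Set.Icc (0:ℝ) 1) (y : ℝ) :
    |x - max 0 (min 1 y)| ≤ |x - y| := by
  have h : x = max 0 (min 1 x) := by rw [min_eq_right hx.2, max_eq_right hx.1]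
  calc |x - max 0 (min 1 y)| = |max (min 1 x) 0 - max (min 1 y) 0| := by
        rw [max_comm _ (0:ℝ), max_comm _ (0:ℝ), ← h]
    _ ≤ |min 1 x - min 1 y| := abs_max_sub_max_le_abs _ _ _
    _ ≤ |x - y| := by simpa using abs_min_sub_min_le_max 1 x 1 y

/-- Finitely many bounded measurable functions on the square are simultaneously approximated in
`L¹` by step functions on a fine uniform grid. -/
theorem exists_grid_approx {ι : Type*} [Finite ι] (f : ι → Sq → ℝ) (hf : ∀ n, Measurable (f n))
    (hb : ∀ n p, f n p ∈ Set.Icc (0:ℝ) 1) (η : ℝ) (hη : 0 < η) (k : ℕ) [NeZero k] :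
    ∃ m : ℕ, 0 < m ∧ ∀ _ : NeZero (k * m), ∃ M : ι → Fin (k * m) → Fin (k * m) → ℝ,
      (∀ n a b, M n a b ∈ Set.Icc (0:ℝ) 1) ∧
      ∀ n, ∫ p : Sq, |f n p - M n (cellIdx (k * m) p.1) (cellIdx (k * m) p.2)| ≤ η := by
  have hint : ∀ n, Integrable (f n) (volume : Measure Sq) := fun n =>
    Integrable.of_bound (hf n).aestronglyMeasurable 1 (.of_forall fun p => by
      rw [Real.norm_eq_abs, abs_of_nonneg (hb n p).1]
      exact (hb n p).2)
  have happ := fun n => (hint n).exists_boundedContinuous_integral_sub_le (half_pos hη)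
  choose g hg hgi using happ
  have hunif : ∀ n, ∃ δ > 0, ∀ p q : Sq, dist p q < δ → dist (g n p) (g n q) < η / 2 := fun n =>
    Metric.uniformContinuous_iff.1
      (CompactSpace.uniformContinuous_of_continuous (g n).continuous) (η / 2) (half_pos hη)
  choose δ hδ hgδ using hunif
  have hm : ∀ᶠ m : ℕ in atTop, 0 < m ∧ ∀ n, 1 / ((m:ℕ):ℝ) < δ n := by
    refine (eventually_gt_atTop 0).and (eventually_all.2 fun n => ?_)
    exact (tendsto_const_div_atTop_nhds_zero_nat 1).eventually_lt_const (hδ n)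
  obtain ⟨m, hm0, hmδ⟩ := hm.exists
  refine ⟨m, hm0, fun _ => ⟨fun n a b => max 0 (min 1 (g n (cellEnd a, cellEnd b))), fun n a b =>
    ⟨le_max_left _ _, max_le zero_le_one (min_le_left _ _)⟩, fun n => ?_⟩⟩
  have hkm : 1 / (((k * m : ℕ)) : ℝ) < δ n := by
    refine lt_of_le_of_lt ?_ (hmδ n)
    refine one_div_le_one_div_of_le (by exact_mod_cast hm0) ?_
    exact_mod_cast Nat.le_mul_of_pos_left m (NeZero.pos k)
  have hgn : Integrable (fun p => g n p) (volume : Measure Sq) := hgi n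
  have hle : ∀ᵐ p : Sq ∂volume, |f n p - max 0 (min 1 (g n (cellEnd (cellIdx (k * m) p.1),
      cellEnd (cellIdx (k * m) p.2))))| ≤ |f n p - g n p| + η / 2 := by
    filter_upwards [ae_pos_sq] with p hp
    have hd : dist p (cellEnd (cellIdx (k * m) p.1), cellEnd (cellIdx (k * m) p.2)) < δ n :=
      lt_of_le_of_lt (max_le (dist_cellEnd_cellIdx_le _ hp.1) (dist_cellEnd_cellIdx_le _ hp.2)) hkm
    have h1 := hgδ n _ _ hd
    rw [Real.dist_eq] at h1
    exact (abs_sub_max_min_le (hb n p) _).trans ((abs_sub_le _ (g n p) _).trans (by linarith))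
  calc _ ≤ ∫ p : Sq, (|f n p - g n p| + η / 2) := by
        refine integral_mono_of_nonneg (.of_forall fun p => abs_nonneg _) ?_ hle
        exact ((hint n).sub hgn).abs.add (integrable_const _)
    _ = (∫ p : Sq, |f n p - g n p|) + η / 2 := by
        have hi : Integrable (fun p => |f n p - g n p|) (volume : Measure Sq) :=
          ((hint n).sub hgn).abs
        rw [integral_add hi (integrable_const _)]
        simp
    _ ≤ η := by
        have := hg n
        simp only [Real.norm_eq_abs] at this
        linarith

section kernelIntegral

/-- A measurable kernel of measures with total mass at most one. -/
def IsSubKernel (U : Sq → Measure Z) : Prop :=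
  (∀ A : Set Z, MeasurableSet A → Measurable fun p => U p A) ∧ ∀ p, U p Set.univ ≤ 1

omit [TopologicalSpace Z] in
theorem IsProbGraphon.isSubKernel {W : Sq → Measure Z} (hW : IsProbGraphon W) : IsSubKernel W :=
  ⟨hW.1, fun p => by
    have := hW.2 p
    exact prob_le_one⟩

omit [TopologicalSpace Z] in
theorem IsProbGraphon.relabel {W : Sq → Measure Z} (hW : IsProbGraphon W)
    {φ : unitInterval → unitInterval} (hφ : Measurable φ) : IsProbGraphon (relabel W φ) :=
  ⟨fun A hA => (hW.1 A hA).comp (hφ.prodMap hφ), fun _ => hW.2 _⟩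

/-- The kernel in the sense of Mathlib associated with a measurable kernel. -/
def IsSubKernel.kernel {U : Sq → Measure Z} (hU : IsSubKernel U) : ProbabilityTheory.Kernel Sq Z :=
  ⟨U, Measure.measurable_of_measurable_coe _ hU.1⟩

variable [OpensMeasurableSpace Z]

theorem IsSubKernel.measurable_integral {U : Sq → Measure Z} (hU : IsSubKernel U)
    (f : BoundedContinuousFunction Z ℝ) : Measurable fun p => ∫ z, f z ∂(U p) := by
  have hf : StronglyMeasurable f := f.continuous.measurable.stronglyMeasurable
  exact (hf.integral_kernel (κ := hU.kernel)).measurable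

omit [TopologicalSpace Z] [OpensMeasurableSpace Z] in
theorem IsSubKernel.isFiniteMeasure_kernelInt {U : Sq → Measure Z} (hU : IsSubKernel U)
    (A : Set Sq) : IsFiniteMeasure (kernelInt U A) := by
  refine ⟨?_⟩
  rw [kernelInt, Measure.bind_apply MeasurableSet.univ
    (Measure.measurable_of_measurable_coe _ hU.1).aemeasurable]
  calc ∫⁻ p in A, U p Set.univ ≤ ∫⁻ _ in A, 1 := lintegral_mono fun p => hU.2 p
    _ < ⊤ := by simp

theorem IsSubKernel.integral_kernelInt {U : Sq → Measure Z} (hU : IsSubKernel U)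
    (f : BoundedContinuousFunction Z ℝ) (A : Set Sq) :
    ∫ z, f z ∂(kernelInt U A) = ∫ p in A, ∫ z, f z ∂(U p) := by
  have hfin := hU.isFiniteMeasure_kernelInt A
  have h := ProbabilityTheory.Kernel.integral_comp (a := ())
    (κ := ProbabilityTheory.Kernel.const Unit ((volume : Measure Sq).restrict A))
    (η := hU.kernel) (f := f)
  rw [ProbabilityTheory.Kernel.comp_apply, ProbabilityTheory.Kernel.const_apply] at h
  exact h (f.integrable (kernelInt U A))

end kernelIntegral

/-- The measure-valued stepfunction on the uniform grid with given values. -/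
def stepKernel {k : ℕ} (μ : Fin k → Fin k → Measure Z) : Sq → Measure Z :=
  fun p => ∑ i : Fin k, ∑ j : Fin k,
    Set.indicator (stepSet k i ×ˢ stepSet k j) (fun _ => μ i j) p

omit [TopologicalSpace Z] in
theorem stepKernel_eq {k : ℕ} [NeZero k] (μ : Fin k → Fin k → Measure Z) {p : Sq}
    (hp : (0:ℝ) < p.1 ∧ (0:ℝ) < p.2) :
    stepKernel μ p = μ (cellIdx k p.1) (cellIdx k p.2) := by
  classical
  have h : ∀ i j, Set.indicator (stepSet k i ×ˢ stepSet k j) (fun _ => μ i j) p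
      = if cellIdx k p.1 = i then (if cellIdx k p.2 = j then μ i j else 0) else 0 := by
    intro i j
    simp only [Set.indicator_apply, Set.mem_prod, ← cellIdx_eq_iff hp.1, ← cellIdx_eq_iff hp.2,
      ite_and]
  simp [stepKernel, h]

omit [TopologicalSpace Z] in
theorem isSubKernel_stepKernel {k : ℕ} [NeZero k] (μ : Fin k → Fin k → Measure Z)
    (hμ : ∀ i j, IsProbabilityMeasure (μ i j)) : IsSubKernel (stepKernel μ) := by
  constructor
  · intro A hA
    have : (fun p => stepKernel μ p A) = fun p => ∑ i : Fin k, ∑ j : Fin k,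
        Set.indicator (stepSet k i ×ˢ stepSet k j) (fun _ => μ i j A) p := by
      ext p
      simp only [stepKernel, Measure.coe_finsetSum, Finset.sum_apply]
      refine Finset.sum_congr rfl fun i _ => Finset.sum_congr rfl fun j _ => ?_
      by_cases h : p ∈ stepSet k i ×ˢ stepSet k j
      · rw [Set.indicator_of_mem h, Set.indicator_of_mem h]
      · rw [Set.indicator_of_notMem h, Set.indicator_of_notMem h, Measure.coe_zero, Pi.zero_apply]
    rw [this]
    exact Finset.measurable_sum _ fun i _ => Finset.measurable_sum _ fun j _ =>
      measurable_const.indicator ((measurableSet_stepSet k i).prod (measurableSet_stepSet k j))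
  · intro p
    by_cases hp : (0:ℝ) < p.1 ∧ (0:ℝ) < p.2
    · rw [stepKernel_eq μ hp]
      have := hμ (cellIdx k p.1) (cellIdx k p.2)
      exact prob_le_one
    · have : stepKernel μ p = 0 := by
        refine Finset.sum_eq_zero fun i _ => Finset.sum_eq_zero fun j _ => ?_
        refine Set.indicator_of_notMem (fun h => hp ⟨?_, ?_⟩) _
        · exact lt_of_le_of_lt (by positivity) h.1.1
        · exact lt_of_le_of_lt (by positivity) h.2.1
      simp [this]

theorem IsConvDet.integral_mem_Icc {F : ℕ → BoundedContinuousFunction Z ℝ} (hF : IsConvDet F)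
    (n : ℕ) (μ : Measure Z) (hμ : μ Set.univ ≤ 1) : ∫ z, F n z ∂μ ∈ Set.Icc (0:ℝ) 1 := by
  have hfin : IsFiniteMeasure μ := ⟨hμ.trans_lt ENNReal.one_lt_top⟩
  refine ⟨integral_nonneg fun z => (hF.2.1 n z).1, ?_⟩
  calc ∫ z, F n z ∂μ ≤ ∫ _, (1:ℝ) ∂μ :=
        integral_mono_of_nonneg (.of_forall fun z => (hF.2.1 n z).1) (integrable_const _)
          (.of_forall fun z => (hF.2.1 n z).2)
    _ = μ.real Set.univ := by simp
    _ ≤ 1 := ENNReal.toReal_le_of_le_ofReal zero_le_one (by simpa using hμ)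

theorem tsum_half_pow_mul_le {a : ℕ → ℝ} (h0 : a 0 = 0) (ha0 : ∀ n, 0 ≤ a n)
    (ha1 : ∀ n, a n ≤ 1) (n₀ : ℕ) :
    ∑' n, (1 / 2 : ℝ) ^ n * a n ≤
      (1 / 2) ^ n₀ + ∑ n : Fin n₀, (1 / 2 : ℝ) ^ (n.val + 1) * a (n + 1) := by
  have hle : ∀ n, (1 / 2 : ℝ) ^ n * a n ≤ (1 / 2) ^ n := fun n =>
    mul_le_of_le_one_right (by positivity) (ha1 n)
  have hs : Summable fun n => (1 / 2 : ℝ) ^ n * a n :=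
    Summable.of_nonneg_of_le (fun n => mul_nonneg (by positivity) (ha0 n)) hle
      summable_geometric_two
  have hs' := (summable_nat_add_iff (n₀ + 1)).2 hs
  have h2 := (summable_nat_add_iff (n₀ + 1)).2 summable_geometric_two
  have htail := Summable.tsum_le_tsum (fun n => hle (n + (n₀ + 1))) hs' h2
  have hgeom : ∑' n : ℕ, (1 / 2 : ℝ) ^ (n + (n₀ + 1)) = (1 / 2) ^ n₀ := by
    simp only [pow_add, tsum_mul_right, tsum_geometric_two]
    ring
  rw [hgeom] at htail
  rw [← hs.sum_add_tsum_nat_add (n₀ + 1), Finset.sum_range_succ', h0, mul_zero, add_zero,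
    Finset.sum_range, add_comm]
  exact add_le_add_left htail _

theorem Fdist_le {F : ℕ → BoundedContinuousFunction Z ℝ} (μ ν : Measure Z)
    (h0 : ∫ z, F 0 z ∂μ = ∫ z, F 0 z ∂ν)
    (h1 : ∀ n, |∫ z, F n z ∂μ - ∫ z, F n z ∂ν| ≤ 1) (n₀ : ℕ) :
    Fdist F μ ν ≤ (1 / 2) ^ n₀ + ∑ n : Fin n₀, (1 / 2 : ℝ) ^ (n.val + 1) *
      |∫ z, F (n + 1) z ∂μ - ∫ z, F (n + 1) z ∂ν| :=
  tsum_half_pow_mul_le (a := fun n => |∫ z, F n z ∂μ - ∫ z, F n z ∂ν|) (by simp [h0])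
    (fun _ => abs_nonneg _) h1 n₀

theorem Fdist_nonneg (F : ℕ → BoundedContinuousFunction Z ℝ) (μ ν : Measure Z) :
    0 ≤ Fdist F μ ν :=
  tsum_nonneg fun _ => by positivity

theorem cutDistF_nonneg (F : ℕ → BoundedContinuousFunction Z ℝ) (U V : Sq → Measure Z) :
    0 ≤ cutDistF F U V :=
  Real.iSup_nonneg fun _ => Fdist_nonneg F _ _

theorem deltaCut_le_of_isMP (F : ℕ → BoundedContinuousFunction Z ℝ) (U V : Sq → Measure Z)
    {φ : unitInterval → unitInterval} (hφ : IsMP φ) (hb : Function.Bijective φ) :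
    deltaCut (cutDistF F) U V ≤ cutDistF F U (relabel V φ) :=
  ciInf_le (f := fun φ : {φ : unitInterval → unitInterval // IsMP φ ∧ Function.Bijective φ} =>
    cutDistF F U (relabel V φ.val)) ⟨0, by rintro _ ⟨_, rfl⟩; exact cutDistF_nonneg F _ _⟩
    ⟨φ, hφ, hb⟩

section kernelIntegralBounds

variable [OpensMeasurableSpace Z]

omit [TopologicalSpace Z] [OpensMeasurableSpace Z] in
theorem IsSubKernel.kernelInt_univ_le {U : Sq → Measure Z} (hU : IsSubKernel U) (A : Set Sq) :
    kernelInt U A Set.univ ≤ 1 := by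
  rw [kernelInt, Measure.bind_apply MeasurableSet.univ
    (Measure.measurable_of_measurable_coe _ hU.1).aemeasurable]
  calc ∫⁻ p in A, U p Set.univ ≤ ∫⁻ _ in A, 1 := lintegral_mono fun p => hU.2 p
    _ ≤ 1 := by simpa using prob_le_one

/-- Comparison of the cut distance with finitely many scalar integrals, for kernels with almost
surely unit mass. -/
theorem cutDistF_le {F : ℕ → BoundedContinuousFunction Z ℝ} (hF : IsConvDet F)
    {U V : Sq → Measure Z} (hU : IsSubKernel U) (hV : IsSubKernel V)
    (hU1 : ∀ᵐ p, U p Set.univ = 1) (hV1 : ∀ᵐ p, V p Set.univ = 1) (n₀ : ℕ) {K : ℝ}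
    (hK : ∀ S T : Set unitInterval, MeasurableSet S → MeasurableSet T →
      ∑ n : Fin n₀, (1 / 2 : ℝ) ^ (n.val + 1) *
        |∫ p in S ×ˢ T, (∫ z, F (n + 1) z ∂(U p) - ∫ z, F (n + 1) z ∂(V p))| ≤ K) :
    cutDistF F U V ≤ (1 / 2) ^ n₀ + K := by
  have : Nonempty {p : Set unitInterval × Set unitInterval //
      MeasurableSet p.1 ∧ MeasurableSet p.2} := ⟨⟨(∅, ∅), .empty, .empty⟩⟩
  refine ciSup_le fun ⟨⟨S, T⟩, hS, hT⟩ => ?_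
  have hint : ∀ {U : Sq → Measure Z}, IsSubKernel U → ∀ n,
      Integrable (fun p => ∫ z, F n z ∂(U p)) := fun {U} hU n =>
    Integrable.of_bound (hU.measurable_integral (F n)).aestronglyMeasurable 1
      (.of_forall fun p => by
        have := hF.integral_mem_Icc n _ (hU.2 p)
        rw [Real.norm_eq_abs, abs_le]
        constructor <;> linarith [this.1, this.2])
  refine (Fdist_le _ _ ?_ (fun n => ?_) n₀).trans (add_le_add_right ?_ _)
  · rw [hU.integral_kernelInt, hV.integral_kernelInt]
    refine integral_congr_ae (ae_restrict_of_ae ?_)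
    filter_upwards [hU1, hV1] with p h1 h2
    simp [hF.1, Measure.real, h1, h2]
  · have h1 := hF.integral_mem_Icc n _ (hU.kernelInt_univ_le (S ×ˢ T))
    have h2 := hF.integral_mem_Icc n _ (hV.kernelInt_univ_le (S ×ˢ T))
    rw [abs_le]
    constructor <;> linarith [h1.1, h1.2, h2.1, h2.2]
  · refine le_trans (le_of_eq ?_) (hK S T hS hT)
    refine Finset.sum_congr rfl fun n _ => ?_
    rw [hU.integral_kernelInt, hV.integral_kernelInt,
      integral_sub (hint hU _).integrableOn (hint hV _).integrableOn]

end kernelIntegralBounds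

theorem exists_sign_sum_abs_eq {ι : Type*} [Fintype ι] (c x : ι → ℝ) :
    ∃ σ : ι → ℤˣ, ∑ n, c n * |x n| = ∑ n, c n * ((σ n : ℤ) : ℝ) * x n := by
  refine ⟨fun n => if 0 ≤ x n then 1 else -1, Finset.sum_congr rfl fun n _ => ?_⟩
  dsimp only
  split_ifs with h
  · simp [abs_of_nonneg h]
  · simp [abs_of_neg (not_le.1 h)]

theorem sum_half_pow_le_one (n₀ : ℕ) : ∑ n : Fin n₀, (1 / 2 : ℝ) ^ (n.val + 1) ≤ 1 := by
  have : ∀ n, ∑ i ∈ Finset.range n, (1 / 2 : ℝ) ^ (i + 1) = 1 - (1 / 2) ^ n := by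
    intro n
    induction n with
    | zero => simp
    | succ n ih => rw [Finset.sum_range_succ, ih]; ring
  rw [Finset.sum_range (f := fun i => (1 / 2 : ℝ) ^ (i + 1)) |>.symm, this]
  have : (0:ℝ) < (1 / 2) ^ n₀ := by positivity
  linarith

omit [TopologicalSpace Z] in
theorem ae_stepKernel_univ {k : ℕ} [NeZero k] (μ : Fin k → Fin k → Measure Z)
    (hμ : ∀ i j, IsProbabilityMeasure (μ i j)) : ∀ᵐ p, stepKernel μ p Set.univ = 1 := by
  filter_upwards [ae_pos_sq] with p hp
  rw [stepKernel_eq μ hp]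
  exact (hμ _ _).measure_univ

theorem deltaCut_stepKernel_le [OpensMeasurableSpace Z] {F : ℕ → BoundedContinuousFunction Z ℝ}
    (hF : IsConvDet F) {W : Sq → Measure Z} (hW : IsProbGraphon W) {k m : ℕ} [NeZero k]
    (N : ℕ) [NeZero N] (hN : N = k * m) (μ : Fin k → Fin k → Measure Z)
    (hμ : ∀ i j, IsProbabilityMeasure (μ i j))
    (st : Fin N → Fin k) (hst : ∀ a, (st a).val = a.val / m)
    (π : Equiv.Perm (Fin N)) {n₀ : ℕ} (M : Fin n₀ → Fin N → Fin N → ℝ)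
    {η K : ℝ} (hη : 0 ≤ η)
    (hM : ∀ n : Fin n₀, ∫ p : Sq, |∫ z, F (n + 1) z ∂(W p) -
      M n (cellIdx N p.1) (cellIdx N p.2)| ≤ η)
    (hK : ∀ (σ : Fin n₀ → ℤˣ) (S T : Finset (Fin N)), ∑ a ∈ S, ∑ b ∈ T,
      ∑ n : Fin n₀, (1 / 2 : ℝ) ^ (n.val + 1) * ((σ n : ℤ) : ℝ) *
        (∫ z, F (n + 1) z ∂(μ (st a) (st b)) - M n (π a) (π b)) ≤ K * (N:ℝ) ^ 2) :
    deltaCut (cutDistF F) (stepKernel μ) W ≤ (1 / 2) ^ n₀ + (η + K) := by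
  have hN0 : (0:ℝ) < N := by exact_mod_cast Nat.pos_of_ne_zero (NeZero.ne N)
  have hstN : ∀ t, cellIdx k t = st (cellIdx N t) := fun t => by
    subst hN
    exact Fin.ext ((cellIdx_mul_div k m t).symm.trans (hst _).symm)
  set φ := permMap N π with hφ
  have hφm : Measurable φ := measurable_permMap π
  have hWφ := hW.relabel hφm
  have hU := isSubKernel_stepKernel μ hμ
  have hV := hWφ.isSubKernel
  refine (deltaCut_le_of_isMP F _ _ (isMP_permMap π) (bijective_permMap π)).trans
    (cutDistF_le hF hU hV (ae_stepKernel_univ μ hμ)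
      (.of_forall fun p => (hWφ.2 p).measure_univ) n₀ fun S T hS hT => ?_)
  set g : Fin n₀ → Fin N → Fin N → ℝ := fun n a b =>
    ∫ z, F (n + 1) z ∂(μ (st a) (st b)) - M n (π a) (π b) with hg
  set G : Fin n₀ → Sq → ℝ := fun n p => g n (cellIdx N p.1) (cellIdx N p.2) with hG
  set R : Fin n₀ → Sq → ℝ := fun n p => ∫ z, F (n + 1) z ∂(W p) -
    M n (cellIdx N p.1) (cellIdx N p.2) with hR
  have hcell : Measurable fun p : Sq => (cellIdx N p.1, cellIdx N p.2) :=
    ((measurable_cellIdx N).comp measurable_fst).prodMk ((measurable_cellIdx N).comp measurable_snd)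
  have hcomp : ∀ f : Fin N → Fin N → ℝ,
      Integrable fun p : Sq => f (cellIdx N p.1) (cellIdx N p.2) := fun f =>
    Integrable.of_bound (((measurable_of_finite fun q : Fin N × Fin N => f q.1 q.2).comp
      hcell).aestronglyMeasurable) (∑ a, ∑ b, |f a b|) (.of_forall fun p => by
        refine le_trans ?_ (Finset.single_le_sum (f := fun a => ∑ b, |f a b|)
          (fun a _ => Finset.sum_nonneg fun b _ => abs_nonneg _) (Finset.mem_univ (cellIdx N p.1)))
        exact Finset.single_le_sum (f := fun b => |f (cellIdx N p.1) b|)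
          (fun b _ => abs_nonneg _) (Finset.mem_univ (cellIdx N p.2)))
  have hWint : ∀ n, Integrable fun p => ∫ z, F n z ∂(W p) := fun n =>
    Integrable.of_bound (hW.isSubKernel.measurable_integral (F n)).aestronglyMeasurable 1
      (.of_forall fun p => by
        have := hF.integral_mem_Icc n _ (hW.isSubKernel.2 p)
        rw [Real.norm_eq_abs, abs_le]
        constructor <;> linarith [this.1, this.2])
  have hRint : ∀ n, Integrable (R n) := fun n => (hWint _).sub (hcomp _)
  have hmp : MeasurePreserving (Prod.map φ φ) (volume : Measure Sq) volume :=
    MeasurePreserving.prod (isMP_permMap π) (isMP_permMap π)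
  have hRφint : ∀ n, Integrable (R n ∘ Prod.map φ φ) := fun n =>
    hmp.integrable_comp_of_integrable (hRint n)
  have hsplit : ∀ n : Fin n₀, ∫ p in S ×ˢ T, (∫ z, F (n + 1) z ∂(stepKernel μ p) -
      ∫ z, F (n + 1) z ∂(relabel W φ p)) =
      (∫ p in S ×ˢ T, G n p) - ∫ p in S ×ˢ T, R n (Prod.map φ φ p) := by
    intro n
    refine Eq.trans ?_ (integral_sub (hcomp (g n)).integrableOn (hRφint n).integrableOn)
    refine integral_congr_ae (ae_restrict_of_ae ?_)
    filter_upwards [ae_pos_sq] with p hp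
    simp only [hR, Prod.map, stepKernel_eq μ hp, hstN, relabel, hφ,
      cellIdx_permMap π hp.1, cellIdx_permMap π hp.2]
    ring
  have hRle : ∀ n, |∫ p in S ×ˢ T, R n (Prod.map φ φ p)| ≤ η := by
    intro n
    calc |∫ p in S ×ˢ T, R n (Prod.map φ φ p)| ≤ ∫ p in S ×ˢ T, |R n (Prod.map φ φ p)| :=
          abs_integral_le_integral_abs
      _ ≤ ∫ p, |R n (Prod.map φ φ p)| :=
          setIntegral_le_integral (hRφint n).abs (.of_forall fun p => abs_nonneg _)
      _ = ∫ p, |R n p| := by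
          have h := integral_map (μ := (volume : Measure Sq)) hmp.measurable.aemeasurable
            (f := fun p => |R n p|)
            (by rw [hmp.map_eq]; exact (hRint n).abs.aestronglyMeasurable)
          rw [hmp.map_eq] at h
          exact h.symm
      _ ≤ η := hM n
  have hmain : ∑ n : Fin n₀, (1 / 2 : ℝ) ^ (n.val + 1) * |∫ p in S ×ˢ T, G n p| ≤ K := by
    obtain ⟨σ, hσ⟩ := exists_sign_sum_abs_eq (fun n : Fin n₀ => (1 / 2 : ℝ) ^ (n.val + 1))
      fun n => ∫ p in S ×ˢ T, G n p
    rw [hσ]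
    set s : Set unitInterval → Fin N → ℝ := fun S a =>
      N * volume.real (cellIdx N ⁻¹' {a} ∩ S) with hs
    have hs01 : ∀ S a, s S a ∈ Set.Icc (0:ℝ) 1 := by
      intro S a
      refine ⟨by positivity, ?_⟩
      have : volume.real (cellIdx N ⁻¹' {a} ∩ S) ≤ 1 / N := by
        refine (measureReal_mono Set.inter_subset_left).trans_eq ?_
        rw [Measure.real, volume_cellIdx_preimage, ENNReal.toReal_ofReal (by positivity)]
      calc N * volume.real (cellIdx N ⁻¹' {a} ∩ S) ≤ N * (1 / N) := by gcongr
        _ = 1 := by field_simp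
    have hw := sum_weight_mul_weight_le (fun a b => ∑ n : Fin n₀,
      (1 / 2 : ℝ) ^ (n.val + 1) * ((σ n : ℤ) : ℝ) * g n a b) (K * N ^ 2)
      (fun S T => hK σ S T) (s S) (s T) (hs01 S) (hs01 T)
    have heq : ∑ a, ∑ b, s S a * s T b * ∑ n : Fin n₀,
        (1 / 2 : ℝ) ^ (n.val + 1) * ((σ n : ℤ) : ℝ) * g n a b = (N:ℝ) ^ 2 *
        ∑ n : Fin n₀, (1 / 2 : ℝ) ^ (n.val + 1) * ((σ n : ℤ) : ℝ) * ∫ p in S ×ˢ T, G n p := by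
      simp only [hG, setIntegral_cellIdx, Finset.mul_sum, hs]
      conv_rhs => rw [Finset.sum_comm]
      refine Finset.sum_congr rfl fun a _ => ?_
      rw [Finset.sum_comm]
      refine Finset.sum_congr rfl fun n _ => Finset.sum_congr rfl fun b _ => ?_
      ring
    rw [heq] at hw
    have : (0:ℝ) < N ^ 2 := by positivity
    nlinarith
  calc _ ≤ ∑ n : Fin n₀, ((1 / 2 : ℝ) ^ (n.val + 1) * |∫ p in S ×ˢ T, G n p| +
        (1 / 2 : ℝ) ^ (n.val + 1) * η) := by
        refine Finset.sum_le_sum fun n _ => ?_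
        rw [hsplit, ← mul_add]
        gcongr
        exact (abs_sub _ _).trans (add_le_add_right (hRle n) _)
    _ ≤ K + 1 * η := by
        rw [Finset.sum_add_distrib, ← Finset.sum_mul]
        exact add_le_add hmain (mul_le_mul_of_nonneg_right (sum_half_pow_le_one n₀) hη)
    _ = η + K := by ring

theorem pi_measure_exists_card_gt_le {κ α : Type*} [Fintype κ] [Fintype α] [MeasurableSpace α]
    [DiscreteMeasurableSpace α] (ν : Measure α) [IsProbabilityMeasure ν]
    (hν : ∀ f : α → ℝ, ∫ a, f a ∂ν = (∑ a, f a) / Fintype.card α)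
    (p : α → ℕ) (R : ℕ) (hp : ∀ a, p a < R) (t : ℝ) (ht : 0 ≤ t) :
    Measure.pi (fun _ : κ => ν) {x | ∃ A : Finset ℕ, Fintype.card κ *
      (((Finset.univ.filter fun a => p a ∈ A).card : ℝ) / Fintype.card α + t) <
        ((Finset.univ.filter fun i => p (x i) ∈ A).card : ℝ)}
      ≤ 2 ^ R * ENNReal.ofReal (Real.exp (-(Fintype.card κ * t ^ 2 / 2))) := by
  classical
  set X : Finset ℕ → α → ℝ := fun A a => if p a ∈ A then 1 else 0 with hX
  have hint : ∀ A, ∫ a, X A a ∂ν =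
      ((Finset.univ.filter fun a => p a ∈ A).card : ℝ) / Fintype.card α := fun A => by
    rw [hν, hX, Finset.sum_boole]
  have hsub : {x : κ → α | ∃ A : Finset ℕ, Fintype.card κ *
      (((Finset.univ.filter fun a => p a ∈ A).card : ℝ) / Fintype.card α + t) <
        ((Finset.univ.filter fun i => p (x i) ∈ A).card : ℝ)} ⊆
      ⋃ A ∈ (Finset.range R).powerset,
        {x | t * Fintype.card κ ≤ ∑ i, (X A (x i) - ∫ a, X A a ∂ν)} := by
    rintro x ⟨A, hA⟩
    simp only [Set.mem_iUnion]
    refine ⟨A ∩ Finset.range R, Finset.mem_powerset.2 Finset.inter_subset_right, ?_⟩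
    have hmem : ∀ a, p a ∈ A ∩ Finset.range R ↔ p a ∈ A := fun a => by simp [hp a]
    simp only [Set.mem_ofPred_eq, Finset.sum_sub_distrib, hint, hmem, Finset.sum_const,
      Finset.card_univ, nsmul_eq_mul]
    simp only [hX, hmem, Finset.sum_boole]
    linarith
  calc _ ≤ _ := measure_mono hsub
    _ ≤ ∑ A ∈ (Finset.range R).powerset, Measure.pi (fun _ : κ => ν)
        {x | t * Fintype.card κ ≤ ∑ i, (X A (x i) - ∫ a, X A a ∂ν)} :=
      measure_biUnion_finset_le _ _
    _ ≤ ∑ A ∈ (Finset.range R).powerset,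
        ENNReal.ofReal (Real.exp (-(Fintype.card κ * t ^ 2 / 2))) :=
      Finset.sum_le_sum fun A _ => pi_measure_hoeffding_le (fun _ : κ => ν) (fun _ => X A)
        (fun _ => .of_discrete) (fun _ a => by simp only [hX]; split_ifs <;> norm_num) t ht
    _ = _ := by simp

theorem abs_intUnits (s : ℤˣ) : |((s : ℤ) : ℝ)| = 1 := by
  rcases Int.units_eq_one_or s with rfl | rfl <;> simp

theorem sum_sign_mul_le {ι : Type*} [Fintype ι] {c : ι → ℝ} (hc : ∀ n, 0 ≤ c n) (σ : ι → ℤˣ)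
    (x : ι → ℝ) : ∑ n, c n * ((σ n : ℤ) : ℝ) * x n ≤ ∑ n, c n * |x n| :=
  Finset.sum_le_sum fun n _ => by
    rw [mul_assoc]
    refine mul_le_mul_of_nonneg_left ((le_abs_self _).trans_eq ?_) (hc n)
    rw [abs_mul, abs_intUnits, one_mul]

theorem abs_sum_sign_mul_le {ι : Type*} [Fintype ι] {c : ι → ℝ} (hc : ∀ n, 0 ≤ c n) (σ : ι → ℤˣ)
    (x : ι → ℝ) : |∑ n, c n * ((σ n : ℤ) : ℝ) * x n| ≤ ∑ n, c n * |x n| :=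
  (Finset.abs_sum_le_sum_abs _ _).trans_eq <| Finset.sum_congr rfl fun n _ => by
    rw [abs_mul, abs_mul, abs_intUnits, mul_one, abs_of_nonneg (hc n)]

theorem pi_measure_exists_sign_sum_sample_gt_le {κ α ι : Type*} [Fintype κ] [Nonempty κ]
    [Fintype α] [Fintype ι] [MeasurableSpace α] [DiscreteMeasurableSpace α] (ν : Measure α)
    [IsProbabilityMeasure ν] (hν : ∀ f : α → ℝ, ∫ a, f a ∂ν = (∑ a, f a) / Fintype.card α)
    (c : ι → ℝ) (hc : ∀ n, 0 ≤ c n) (hc1 : ∑ n, c n ≤ 1)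
    (D : ι → α → α → ℝ) (hD : ∀ n a b, |D n a b| ≤ 1) (ε : ℝ)
    (hcut : ∀ S T : Finset α, ∑ n, c n * |∑ a ∈ S, ∑ b ∈ T, D n a b|
      ≤ ε * (Fintype.card α : ℝ) ^ 2)
    (q : ℕ) (hq : 0 < q) (t : ℝ) (ht : 0 ≤ t) :
    Measure.pi (fun _ : κ => ν) {x | ∃ (σ : ι → ℤˣ) (S T : Finset κ),
      (Fintype.card κ : ℝ) ^ 2 * (ε + 4 / √q) + 2 * Fintype.card κ * (t * Fintype.card κ + 2 * q)
        < ∑ i ∈ S, ∑ j ∈ T, ∑ n, c n * ((σ n : ℤ) : ℝ) * D n (x i) (x j)}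
      ≤ 2 ^ Fintype.card ι * (2 * (2 * Fintype.card κ) ^ q *
        ENNReal.ofReal (Real.exp (-((Fintype.card κ - q) * t ^ 2 / 2)))) := by
  classical
  have h := fun σ : ι → ℤˣ => pi_measure_exists_sum_sample_gt_le (κ := κ) ν hν
    (fun a b => ∑ n, c n * ((σ n : ℤ) : ℝ) * D n a b)
    (fun a b => (abs_sum_sign_mul_le hc σ _).trans <| (Finset.sum_le_sum fun n _ =>
      mul_le_of_le_one_right (hc n) (hD n a b)).trans hc1) ε
    (fun S T => by
      refine le_trans (le_of_eq ?_) ((sum_sign_mul_le hc σ _).trans (hcut S T))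
      simp only [Finset.mul_sum]
      exact (Finset.sum_congr rfl fun a _ => Finset.sum_comm).trans Finset.sum_comm) q hq t ht
  simp only [Set.ofPred_exists] at h ⊢
  refine (measure_iUnion_fintype_le _ _).trans ((Finset.sum_le_sum fun σ _ => h σ).trans_eq ?_)
  simp [Fintype.card_pi, Fintype.card_units_int]

theorem volume_setOf_cellIdx_mem (k N : ℕ) [NeZero N] (E : Set (Fin k → Fin N)) :
    volume {x : Fin k → unitInterval | (fun i => cellIdx N (x i)) ∈ E} =
      Measure.pi (fun _ : Fin k => cellLaw N) E := by
  have h := Measure.pi_map_pi (μ := fun _ : Fin k => (volume : Measure unitInterval))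
    (f := fun _ => cellIdx N) fun _ => (measurable_cellIdx N).aemeasurable
  rw [cellLaw, ← h, Measure.map_apply _ E.toFinite.measurableSet]
  · rfl
  · exact measurable_pi_lambda _ fun i => (measurable_cellIdx N).comp (measurable_pi_apply i)

theorem measurePreserving_eval_pair {k : ℕ} {i j : Fin k} (hij : i ≠ j) :
    MeasurePreserving (fun x : Fin k → unitInterval => (x i, x j)) volume volume := by
  have hm : ∀ i, Measurable fun x : Fin k → unitInterval => x i := measurable_pi_apply
  refine ⟨(hm i).prodMk (hm j), ?_⟩
  have hind : ProbabilityTheory.iIndepFun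
      (fun i (ω : Fin k → unitInterval) => ω i)
      (Measure.pi fun _ : Fin k => (volume : Measure unitInterval)) :=
    ProbabilityTheory.iIndepFun_pi (X := fun i a => a) (fun i => measurable_id.aemeasurable)
  have h := (ProbabilityTheory.indepFun_iff_map_prod_eq_prod_map_map (hm i).aemeasurable
    (hm j).aemeasurable).1 (hind.indepFun hij)
  have he : ∀ i, (Measure.pi fun _ : Fin k => (volume : Measure unitInterval)).map
      (fun x => x i) = volume := fun i =>
    (measurePreserving_eval (fun _ : Fin k => (volume : Measure unitInterval)) i).map_eq
  rw [he, he] at h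
  exact h

theorem volume_sum_pair_gt_le {k : ℕ} (hk : 0 < k) {f : Sq → ℝ} (hf : Measurable f)
    (hf01 : ∀ p, f p ∈ Set.Icc (0:ℝ) 1) {η δ : ℝ} (hδ : 0 < δ)
    (hint : ∫ p, f p ≤ η) :
    volume {x : Fin k → unitInterval | k + δ * k ^ 2 < ∑ i, ∑ j, f (x i, x j)} ≤
      ENNReal.ofReal (η / δ) := by
  have hk0 : (0:ℝ) < k := by exact_mod_cast hk
  have hfi : Integrable f := Integrable.of_bound hf.aestronglyMeasurable 1
    (.of_forall fun p => by rw [Real.norm_eq_abs, abs_of_nonneg (hf01 p).1]; exact (hf01 p).2)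
  set g : (Fin k → unitInterval) → ℝ := fun x =>
    ∑ i, ∑ j, if i = j then 0 else f (x i, x j) with hg
  have hterm : ∀ i j, Integrable fun x : Fin k → unitInterval =>
      if i = j then 0 else f (x i, x j) := by
    intro i j
    by_cases h : i = j
    · simp [h]
    · simp only [h, if_false]
      exact (measurePreserving_eval_pair h).integrable_comp_of_integrable hfi
  have hη : 0 ≤ η := (integral_nonneg fun p => (hf01 p).1).trans hint
  have hgint : ∫ x, g x ≤ k ^ 2 * η := by
    rw [hg, integral_finsetSum _ fun i _ => integrable_finsetSum _ fun j _ => hterm i j]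
    simp only [integral_finsetSum _ fun j _ => hterm _ j]
    calc _ ≤ ∑ i : Fin k, ∑ j : Fin k, η := by
          refine Finset.sum_le_sum fun i _ => Finset.sum_le_sum fun j _ => ?_
          by_cases h : i = j
          · simpa [h] using hη
          · simp only [h, if_false]
            have hmp := measurePreserving_eval_pair h
            have := integral_map (μ := (volume : Measure (Fin k → unitInterval)))
              hmp.measurable.aemeasurable (f := f) hf.aestronglyMeasurable
            rw [hmp.map_eq] at this
            exact this.symm.trans_le hint
      _ = k ^ 2 * η := by simp; ring
  have hgi : Integrable g := integrable_finsetSum _ fun i _ => integrable_finsetSum _ fun j _ =>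
    hterm i j
  have hmarkov := mul_meas_ge_le_integral_of_nonneg (μ := volume) (f := g)
    (.of_forall fun x => Finset.sum_nonneg fun i _ => Finset.sum_nonneg fun j _ => by
      split_ifs
      exacts [le_rfl, (hf01 _).1]) hgi (δ * k ^ 2)
  have hsub : {x : Fin k → unitInterval | k + δ * k ^ 2 < ∑ i, ∑ j, f (x i, x j)} ⊆
      {x | δ * k ^ 2 ≤ g x} := by
    intro x hx
    have : ∑ i, ∑ j, f (x i, x j) ≤ k + g x := by
      calc ∑ i, ∑ j, f (x i, x j) ≤
            ∑ i, ∑ j, ((if i = j then 1 else 0) + if i = j then 0 else f (x i, x j)) := by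
            refine Finset.sum_le_sum fun i _ => Finset.sum_le_sum fun j _ => ?_
            split_ifs
            · simpa using (hf01 _).2
            · simp
        _ = k + g x := by simp [Finset.sum_add_distrib, hg]
    have hx' : k + δ * k ^ 2 < ∑ i, ∑ j, f (x i, x j) := hx
    change δ * k ^ 2 ≤ g x
    linarith
  refine (measure_mono hsub).trans ?_
  rw [← ofReal_measureReal]
  refine ENNReal.ofReal_le_ofReal ?_
  rw [le_div_iff₀ hδ]
  have : (0:ℝ) < k ^ 2 := by positivity
  nlinarith

theorem card_filter_div_eq {k m N : ℕ} (hN : N = k * m) (st : Fin N → Fin k)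
    (hst : ∀ a, (st a).val = a.val / m) (i : Fin k) :
    (Finset.univ.filter fun a => st a = i).card = m := by
  subst hN
  rcases Nat.eq_zero_or_pos m with rfl | hm
  · simp
  have : (Finset.univ.filter fun a => st a = i).image (fun a => a.val) =
      Finset.Ico (m * i.val) (m * i.val + m) := by
    ext a
    simp only [Finset.mem_image, Finset.mem_filter, Finset.mem_univ, true_and, Finset.mem_Ico,
      Fin.ext_iff, hst]
    constructor
    · rintro ⟨a, h, rfl⟩
      rw [Nat.div_eq_iff hm] at h
      have h1 := h.1
      have h2 := h.2
      rw [mul_comm m i.val]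
      omega
    · rintro ⟨h1, h2⟩
      have hi : i.val + 1 ≤ k := i.2
      refine ⟨⟨a, by nlinarith⟩, ?_, rfl⟩
      refine Nat.div_eq_of_lt_le ?_ ?_ <;> simp <;> nlinarith
  rw [← Finset.card_image_of_injective _ Fin.val_injective, this]
  simp

theorem exists_volume_le_forall_deltaCut_le_of_grid [OpensMeasurableSpace Z]
    {F : ℕ → BoundedContinuousFunction Z ℝ} (hF : IsConvDet F) {W : Sq → Measure Z}
    (hW : IsProbGraphon W) {k : ℕ} (hk : 0 < k) (n₀ : ℕ) {ε : ℝ} (hε : 0 ≤ ε) {r : ℕ}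
    (hr : 1 < r * ε ^ 2) {η : ℝ} (hη : 0 < η) {q : ℕ} (hq : 0 < q) {t : ℝ} (ht : 0 ≤ t) {δ : ℝ}
    (hδ : 0 < δ) {m N : ℕ} [NeZero N] (hN : N = k * m) (M : Fin n₀ → Fin N → Fin N → ℝ)
    (hM01 : ∀ n a b, M n a b ∈ Set.Icc (0:ℝ) 1)
    (hM : ∀ n : Fin n₀, ∫ p : Sq, |∫ z, F (n + 1) z ∂(W p) -
      M n (cellIdx N p.1) (cellIdx N p.2)| ≤ η) :
    ∃ B : Set (Fin k → unitInterval), volume B ≤ ENNReal.ofReal (η / δ) +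
        2 ^ n₀ * (2 * (2 * k) ^ q * ENNReal.ofReal (Real.exp (-((k - q) * t ^ 2 / 2)))) +
        2 ^ 4 ^ r * ENNReal.ofReal (Real.exp (-(k * t ^ 2 / 2))) ∧
      ∀ x ∉ B, ∀ (μ : Fin k → Fin k → Measure Z), (∀ i j, IsProbabilityMeasure (μ i j)) →
        ∀ s : ℝ, (∀ (σ : Fin n₀ → ℤˣ) (S T : Finset (Fin k)), ∑ i ∈ S, ∑ j ∈ T,
          ∑ n : Fin n₀, (1 / 2 : ℝ) ^ (n.val + 1) * ((σ n : ℤ) : ℝ) *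
            (∫ z, F (n + 1) z ∂(μ i j) - ∫ z, F (n + 1) z ∂(W (x i, x j))) ≤ s * k ^ 2) →
        deltaCut (cutDistF F) (stepKernel μ) W ≤ (1 / 2) ^ n₀ + (η +
          (s + (1 / k + δ) + (ε + 4 / √q + 2 * (t + 2 * q / k)) + 2 * t + ε)) := by
  have : NeZero k := ⟨hk.ne'⟩
  have hk0 : (0:ℝ) < k := by exact_mod_cast hk
  have hN0 : 0 < N := Nat.pos_of_ne_zero (NeZero.ne N)
  set c : Fin n₀ → ℝ := fun n => (1 / 2) ^ (n.val + 1) with hc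
  have hc0 : ∀ n, 0 ≤ c n := fun n => by positivity
  have hc1 : ∑ n, c n ≤ 1 := sum_half_pow_le_one n₀
  have hWF : ∀ n p, ∫ z, F n z ∂(W p) ∈ Set.Icc (0:ℝ) 1 := fun n p =>
    hF.integral_mem_Icc n _ (hW.isSubKernel.2 p)
  have hsub1 : ∀ {a b : ℝ}, a ∈ Set.Icc (0:ℝ) 1 → b ∈ Set.Icc (0:ℝ) 1 → |a - b| ≤ 1 :=
    fun ha hb => abs_le.2 ⟨by linarith [ha.1, hb.2], by linarith [ha.2, hb.1]⟩
  obtain ⟨p, w, hp, hw, hreg⟩ := exists_weak_regular_labeling c hc0 hc1 M hM01 ε hε r hr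
  set R : Fin n₀ → Sq → ℝ := fun n v => ∫ z, F (n + 1) z ∂(W v) -
    M n (cellIdx N v.1) (cellIdx N v.2) with hR
  have hRm : ∀ n, Measurable (R n) := fun n =>
    (hW.isSubKernel.measurable_integral (F (n + 1))).sub
      ((measurable_of_finite fun e : Fin N × Fin N => M n e.1 e.2).comp
        (((measurable_cellIdx N).comp measurable_fst).prodMk
          ((measurable_cellIdx N).comp measurable_snd)))
  have hR1 : ∀ n v, |R n v| ≤ 1 := fun n v => hsub1 (hWF _ _) (hM01 _ _ _)
  set f : Sq → ℝ := fun v => ∑ n, c n * |R n v| with hf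
  have hfm : Measurable f := Finset.measurable_sum _ fun n _ => (hRm n).abs.const_mul _
  have hf01 : ∀ v, f v ∈ Set.Icc (0:ℝ) 1 := fun v =>
    ⟨Finset.sum_nonneg fun n _ => mul_nonneg (hc0 n) (abs_nonneg _), (Finset.sum_le_sum fun n _ =>
      mul_le_of_le_one_right (hc0 n) (hR1 n v)).trans hc1⟩
  have hfint : ∫ v, f v ≤ η := by
    have hi : ∀ n, Integrable fun v => c n * |R n v| := fun n =>
      (Integrable.of_bound (hRm n).aestronglyMeasurable 1 (.of_forall (hR1 n))).abs.const_mul _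
    rw [hf, integral_finsetSum _ fun n _ => hi n]
    simp only [integral_const_mul]
    calc _ ≤ ∑ n, c n * η := Finset.sum_le_sum fun n _ => mul_le_mul_of_nonneg_left (hM n) (hc0 n)
      _ ≤ η := by rw [← Finset.sum_mul]; exact mul_le_of_le_one_left hη.le hc1
  have hB₁ := volume_sum_pair_gt_le hk hfm hf01 hδ hfint
  have hB₂ := pi_measure_exists_sign_sum_sample_gt_le (κ := Fin k) (cellLaw N)
    (integral_cellLaw N) c hc0 hc1 (fun n a b => M n a b - w n (p a) (p b))
    (fun n a b => hsub1 (hM01 _ _ _) (hw _ _ _)) ε hreg q hq t ht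
  have hB₃ := pi_measure_exists_card_gt_le (κ := Fin k) (cellLaw N) (integral_cellLaw N) p (4 ^ r)
    hp t ht
  rw [← volume_setOf_cellIdx_mem] at hB₂ hB₃
  simp only [Fintype.card_fin] at hB₂ hB₃
  refine ⟨_ ∪ _ ∪ _, (measure_union_le _ _).trans (add_le_add ((measure_union_le _ _).trans
    (add_le_add hB₁ hB₂)) hB₃), fun x hx μ hμ s hs => ?_⟩
  simp only [Set.mem_union, Set.mem_ofPred_eq, not_or, not_exists, not_lt] at hx
  obtain ⟨⟨hx₁, hx₂⟩, hx₃⟩ := hx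
  set st : Fin N → Fin k := fun a => ⟨a.val / m, by
    have := a.2
    exact Nat.div_lt_of_lt_mul (by rw [mul_comm]; omega)⟩ with hst
  obtain ⟨π, hπ⟩ := exists_perm_sum_step_sub_le c hc0 hc1 st m
    (card_filter_div_eq hN st fun _ => rfl) (by simp [hN, mul_comm]) (by simpa using hN0)
    (fun i => cellIdx N (x i)) p t ε (by simpa using hx₃) M w hw hreg
  refine deltaCut_stepKernel_le hF hW N hN μ hμ st (fun _ => rfl) π M hη.le hM fun σ S T => ?_
  have hcell : ∀ (σ : Fin n₀ → ℤˣ) (S T : Finset (Fin k)), ∑ i ∈ S, ∑ j ∈ T,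
      ∑ n, c n * ((σ n : ℤ) : ℝ) * R n (x i, x j) ≤ k + δ * k ^ 2 := by
    intro σ S T
    refine le_trans ?_ hx₁
    calc _ ≤ ∑ i ∈ S, ∑ j ∈ T, f (x i, x j) :=
          Finset.sum_le_sum fun i _ => Finset.sum_le_sum fun j _ => sum_sign_mul_le hc0 σ _
      _ ≤ ∑ i ∈ S, ∑ j, f (x i, x j) := Finset.sum_le_sum fun i _ =>
          Finset.sum_le_sum_of_subset_of_nonneg (Finset.subset_univ _) fun j _ _ => (hf01 _).1
      _ ≤ _ := Finset.sum_le_sum_of_subset_of_nonneg (Finset.subset_univ _) fun i _ _ =>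
          Finset.sum_nonneg fun j _ => (hf01 _).1
  have hfin := hπ (fun n i j => ∫ z, F (n + 1) z ∂(μ i j))
    (s + (1 / k + δ) + (ε + 4 / √q + 2 * (t + 2 * q / k))) (fun σ S T => ?_) σ S T
  · rwa [Fintype.card_fin] at hfin
  · have h₁ := hs σ S T
    have h₂ := hcell σ S T
    have h₃ := hx₂ σ S T
    have hsum : ∑ i ∈ S, ∑ j ∈ T, ∑ n, c n * ((σ n : ℤ) : ℝ) *
        (∫ z, F (n + 1) z ∂(μ i j) - w n (p (cellIdx N (x i))) (p (cellIdx N (x j)))) =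
        (∑ i ∈ S, ∑ j ∈ T, ∑ n, c n * ((σ n : ℤ) : ℝ) *
          (∫ z, F (n + 1) z ∂(μ i j) - ∫ z, F (n + 1) z ∂(W (x i, x j)))) +
        (∑ i ∈ S, ∑ j ∈ T, ∑ n, c n * ((σ n : ℤ) : ℝ) * R n (x i, x j)) +
        ∑ i ∈ S, ∑ j ∈ T, ∑ n, c n * ((σ n : ℤ) : ℝ) *
          (M n (cellIdx N (x i)) (cellIdx N (x j)) -
            w n (p (cellIdx N (x i))) (p (cellIdx N (x j)))) := by
      simp only [← Finset.sum_add_distrib]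
      refine Finset.sum_congr rfl fun i _ => Finset.sum_congr rfl fun j _ =>
        Finset.sum_congr rfl fun n _ => ?_
      simp only [hR]
      ring
    rw [hsum, Fintype.card_fin]
    refine (add_le_add (add_le_add h₁ h₂) h₃).trans_eq ?_
    field_simp

/-- Outside an event of small probability, every sample of `k` points is such that any
stepfunction whose values are close to those of `W` at the sampled points is close to `W`. -/
theorem exists_volume_le_forall_deltaCut_le [OpensMeasurableSpace Z]
    {F : ℕ → BoundedContinuousFunction Z ℝ} (hF : IsConvDet F) {W : Sq → Measure Z}
    (hW : IsProbGraphon W) {k : ℕ} (hk : 0 < k) (n₀ : ℕ) {ε : ℝ} (hε : 0 ≤ ε) {r : ℕ}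
    (hr : 1 < r * ε ^ 2) {η : ℝ} (hη : 0 < η) {q : ℕ} (hq : 0 < q) {t : ℝ} (ht : 0 ≤ t) {δ : ℝ}
    (hδ : 0 < δ) :
    ∃ B : Set (Fin k → unitInterval), volume B ≤ ENNReal.ofReal (η / δ) +
        2 ^ n₀ * (2 * (2 * k) ^ q * ENNReal.ofReal (Real.exp (-((k - q) * t ^ 2 / 2)))) +
        2 ^ 4 ^ r * ENNReal.ofReal (Real.exp (-(k * t ^ 2 / 2))) ∧
      ∀ x ∉ B, ∀ (μ : Fin k → Fin k → Measure Z), (∀ i j, IsProbabilityMeasure (μ i j)) →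
        ∀ s : ℝ, (∀ (σ : Fin n₀ → ℤˣ) (S T : Finset (Fin k)), ∑ i ∈ S, ∑ j ∈ T,
          ∑ n : Fin n₀, (1 / 2 : ℝ) ^ (n.val + 1) * ((σ n : ℤ) : ℝ) *
            (∫ z, F (n + 1) z ∂(μ i j) - ∫ z, F (n + 1) z ∂(W (x i, x j))) ≤ s * k ^ 2) →
        deltaCut (cutDistF F) (stepKernel μ) W ≤ (1 / 2) ^ n₀ + (η +
          (s + (1 / k + δ) + (ε + 4 / √q + 2 * (t + 2 * q / k)) + 2 * t + ε)) := by
  have : NeZero k := ⟨hk.ne'⟩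
  obtain ⟨m, hm, hgrid⟩ := exists_grid_approx (fun (n : Fin n₀) p => ∫ z, F (n + 1) z ∂(W p))
    (fun n => hW.isSubKernel.measurable_integral _)
    (fun n p => hF.integral_mem_Icc _ _ (hW.isSubKernel.2 p)) η hη k
  have hNZ : NeZero (k * m) := ⟨(Nat.mul_pos hk hm).ne'⟩
  obtain ⟨M, hM01, hM⟩ := hgrid hNZ
  exact exists_volume_le_forall_deltaCut_le_of_grid hF hW hk n₀ hε hr hη hq ht hδ rfl M hM01 hM

theorem measurable_measure_pi {α ι Y : Type*} [MeasurableSpace α] [Fintype ι] [MeasurableSpace Y]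
    {κ : α → ι → Measure Y} (hκ : ∀ i, Measurable fun a => κ a i)
    (hp : ∀ a i, IsProbabilityMeasure (κ a i)) : Measurable fun a => Measure.pi (κ a) := by
  refine Measurable.measure_of_isPiSystem_of_isProbabilityMeasure generateFrom_pi.symm
    isPiSystem_pi ?_
  rintro _ ⟨s, hs, rfl⟩
  simp only [Measure.pi_pi]
  exact Finset.measurable_prod _ fun i _ =>
    (Measure.measurable_coe (hs i (Set.mem_univ i))).comp (hκ i)

section sampleLaw

variable {W : Sq → Measure Z} (hW : IsProbGraphon W) {k : ℕ}
include hW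

omit [TopologicalSpace Z] in
theorem IsProbGraphon.measurable_pi_edges : Measurable fun x : Fin k → unitInterval =>
    Measure.pi fun e : Fin k × Fin k => W (x e.1, x e.2) :=
  measurable_measure_pi (fun e => (Measure.measurable_of_measurable_coe _ hW.1).comp
    ((measurable_pi_apply e.1).prodMk (measurable_pi_apply e.2))) fun _ _ => hW.2 _

/-- The conditional law of the edge weights given the sampled points, as a kernel. -/
def IsProbGraphon.edgeKernel (k : ℕ) :
    ProbabilityTheory.Kernel (Fin k → unitInterval) (Fin k × Fin k → Z) :=
  ⟨fun x => Measure.pi fun e : Fin k × Fin k => W (x e.1, x e.2), hW.measurable_pi_edges⟩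

omit [TopologicalSpace Z] in
theorem IsProbGraphon.isMarkovKernel_edgeKernel :
    ProbabilityTheory.IsMarkovKernel (hW.edgeKernel k) :=
  ⟨fun x => by
    have := fun e : Fin k × Fin k => hW.2 (x e.1, x e.2)
    change IsProbabilityMeasure (Measure.pi fun e : Fin k × Fin k => W (x e.1, x e.2))
    infer_instance⟩

omit [TopologicalSpace Z] in
theorem IsProbGraphon.sampleLaw_apply {A : Set ((Fin k → unitInterval) × (Fin k × Fin k → Z))}
    (hA : MeasurableSet A) :
    sampleLaw W k A = ∫⁻ x, (Measure.pi fun e : Fin k × Fin k => W (x e.1, x e.2))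
      (Prod.mk x ⁻¹' A) := by
  have := hW.isMarkovKernel_edgeKernel (k := k)
  have happ : ∀ {A : Set ((Fin k → unitInterval) × (Fin k × Fin k → Z))}, MeasurableSet A →
      ∀ x, ((Measure.pi fun e : Fin k × Fin k => W (x e.1, x e.2)).map (Prod.mk x)) A =
        hW.edgeKernel k x (Prod.mk x ⁻¹' A) := fun hA x =>
    Measure.map_apply measurable_prodMk_left hA
  have hm : Measurable fun x : Fin k → unitInterval =>
      (Measure.pi fun e : Fin k × Fin k => W (x e.1, x e.2)).map (Prod.mk x) := by
    refine Measure.measurable_of_measurable_coe _ fun A hA => ?_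
    simp only [happ hA]
    exact ProbabilityTheory.Kernel.measurable_kernel_prodMk_left hA
  rw [sampleLaw, Measure.bind_apply hA hm.aemeasurable]
  exact lintegral_congr fun x => happ hA x

omit [TopologicalSpace Z] in
theorem IsProbGraphon.one_sub_le_sampleLaw {B : Set (Fin k → unitInterval)} {b e : ℝ≥0∞}
    (hB : volume B ≤ b) {E : Set ((Fin k → unitInterval) × (Fin k × Fin k → Z))}
    (hE : MeasurableSet E) (he : ∀ x, (Measure.pi fun e : Fin k × Fin k => W (x e.1, x e.2))
      (Prod.mk x ⁻¹' E) ≤ e)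
    {G : Set ((Fin k → unitInterval) × (Fin k × Fin k → Z))}
    (hG : ∀ v, v.1 ∉ B → v ∉ E → v ∈ G) : 1 - (b + e) ≤ sampleLaw W k G := by
  have hmk := hW.isMarkovKernel_edgeKernel (k := k)
  set B' := toMeasurable volume B
  have hB' : MeasurableSet B' := measurableSet_toMeasurable _ _
  set A : Set ((Fin k → unitInterval) × (Fin k × Fin k → Z)) := Prod.fst ⁻¹' B' ∪ E with hA
  have hAm : MeasurableSet A := (measurable_fst hB').union hE
  have huniv : sampleLaw W k Set.univ = 1 := by
    have h1 : ∀ x : Fin k → unitInterval,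
        (Measure.pi fun e : Fin k × Fin k => W (x e.1, x e.2)) Set.univ = 1 :=
      fun x => (hmk.isProbabilityMeasure x).measure_univ
    rw [hW.sampleLaw_apply MeasurableSet.univ]
    simp only [Set.preimage_univ, h1]
    simp
  have hAle : sampleLaw W k A ≤ b + e := by
    rw [hW.sampleLaw_apply hAm]
    calc _ ≤ ∫⁻ x, (B'.indicator 1 x + e) := by
          refine lintegral_mono fun x => (measure_union_le _ _).trans (add_le_add ?_ (he x))
          by_cases hx : x ∈ B'
          · rw [Set.indicator_of_mem hx]
            have := hmk.isProbabilityMeasure x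
            exact prob_le_one (μ := hW.edgeKernel k x)
          · have : (Measure.pi fun e : Fin k × Fin k => W (x e.1, x e.2)) ∅ = 0 := measure_empty
            exact (measure_mono_null (fun β hβ => hx hβ) this).trans_le zero_le
      _ = volume B + e := by
          rw [lintegral_add_right _ measurable_const, lintegral_indicator_one hB',
            measure_toMeasurable]
          simp
      _ ≤ b + e := by gcongr
  have : IsProbabilityMeasure (sampleLaw W k) := ⟨huniv⟩
  calc 1 - (b + e) ≤ 1 - sampleLaw W k A := tsub_le_tsub_left hAle _
    _ = sampleLaw W k Aᶜ := (prob_compl_eq_one_sub hAm).symm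
    _ ≤ sampleLaw W k G := measure_mono fun v hv => by
        rw [hA, Set.mem_compl_iff, Set.mem_union, not_or] at hv
        exact hG v (fun h => hv.1 (subset_toMeasurable _ _ h)) hv.2

end sampleLaw

theorem IsProbGraphon.pi_edges_exists_gt_le [OpensMeasurableSpace Z]
    {F : ℕ → BoundedContinuousFunction Z ℝ} (hF : IsConvDet F) {k : ℕ}
    (μ : Fin k → Fin k → Measure Z) (hμ : ∀ i j, IsProbabilityMeasure (μ i j)) (n₀ : ℕ) {t : ℝ}
    (ht : 0 ≤ t) :
    (Measure.pi fun e : Fin k × Fin k => μ e.1 e.2) {β | ∃ (σ : Fin n₀ → ℤˣ)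
      (S T : Finset (Fin k)), t * k ^ 2 < ∑ i ∈ S, ∑ j ∈ T,
          ∑ n : Fin n₀, (1 / 2 : ℝ) ^ (n.val + 1) * ((σ n : ℤ) : ℝ) *
            (F (n + 1) (β (i, j)) - ∫ z, F (n + 1) z ∂(μ i j))} ≤
      2 ^ n₀ * (2 ^ k * (2 ^ k * ENNReal.ofReal (Real.exp (-(k ^ 2 * t ^ 2 / 2))))) := by
  classical
  have := fun e : Fin k × Fin k => hμ e.1 e.2
  set c : Fin n₀ → ℝ := fun n => (1 / 2) ^ (n.val + 1) with hc
  have hc0 : ∀ n, 0 ≤ c n := fun n => by positivity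
  have hc1 : ∑ n, c n ≤ 1 := sum_half_pow_le_one n₀
  set Φ : (Fin n₀ → ℤˣ) → Z → ℝ := fun σ z => ∑ n, c n * ((σ n : ℤ) : ℝ) * F (n + 1) z with hΦ
  have hΦm : ∀ σ, Measurable (Φ σ) := fun σ =>
    Finset.measurable_sum _ fun n _ => (F (n + 1)).continuous.measurable.const_mul _
  have hΦ1 : ∀ σ z, |Φ σ z| ≤ 1 := fun σ z =>
    (abs_sum_sign_mul_le hc0 σ _).trans <| (Finset.sum_le_sum fun n _ =>
      mul_le_of_le_one_right (hc0 n) (by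
        rw [abs_of_nonneg (hF.2.1 _ z).1]
        exact (hF.2.1 _ z).2)).trans hc1
  have hΦi : ∀ σ i j, ∫ z, Φ σ z ∂(μ i j) =
      ∑ n, c n * ((σ n : ℤ) : ℝ) * ∫ z, F (n + 1) z ∂(μ i j) := fun σ i j => by
    refine (integral_finsetSum _ fun n _ =>
      ((F (n.val + 1)).integrable (μ i j)).const_mul _).trans ?_
    simp only [integral_const_mul]
  simp only [Set.ofPred_exists]
  refine (measure_iUnion_fintype_le _ _).trans ((Finset.sum_le_sum fun σ _ =>
    (measure_iUnion_fintype_le _ _).trans (Finset.sum_le_sum fun S _ =>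
      (measure_iUnion_fintype_le _ _).trans (Finset.sum_le_sum fun T _ =>
        (measure_mono ?_).trans (pi_measure_hoeffding_le (fun e : Fin k × Fin k => μ e.1 e.2)
          (fun e z => if e ∈ S ×ˢ T then Φ σ z else 0) (fun e => ?_) (fun e z => ?_) t ht)))).trans
            (le_of_eq ?_))
  · intro β hβ
    rw [Set.mem_ofPred_eq] at hβ ⊢
    refine (lt_of_eq_of_lt ?_ (lt_of_lt_of_eq hβ ?_)).le
    · simp [sq]
    · have : ∀ e : Fin k × Fin k, ((if e ∈ S ×ˢ T then Φ σ (β e) else 0) -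
          ∫ z, (if e ∈ S ×ˢ T then Φ σ z else 0) ∂(μ e.1 e.2)) =
          if e ∈ S ×ˢ T then Φ σ (β e) - ∫ z, Φ σ z ∂(μ e.1 e.2) else 0 := fun e => by
        split_ifs <;> simp
      simp only [this]
      rw [← Finset.sum_filter, Finset.filter_mem_eq_inter, Finset.univ_inter, Finset.sum_product]
      refine Finset.sum_congr rfl fun i _ => Finset.sum_congr rfl fun j _ => ?_
      rw [hΦi, hΦ, ← Finset.sum_sub_distrib]
      exact Finset.sum_congr rfl fun n _ => mul_sub _ _ _
  · split_ifs
    exacts [hΦm σ, measurable_const]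
  · split_ifs
    · exact abs_le.1 (hΦ1 σ z)
    · norm_num
  · simp [Fintype.card_units_int, sq]

theorem IsProbGraphon.one_sub_le_sampleLaw_deltaCut_le [OpensMeasurableSpace Z]
    {F : ℕ → BoundedContinuousFunction Z ℝ} (hF : IsConvDet F) {W : Sq → Measure Z}
    (hW : IsProbGraphon W) {k : ℕ} (hk : 0 < k) (n₀ : ℕ) {ε : ℝ} (hε : 0 ≤ ε) {r : ℕ}
    (hr : 1 < r * ε ^ 2) {η : ℝ} (hη : 0 < η) {q : ℕ} (hq : 0 < q) {t : ℝ} (ht : 0 ≤ t) {δ : ℝ}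
    (hδ : 0 < δ) {D : ℝ} (hD : (1 / 2) ^ n₀ + (η +
      ((1 / k + δ) + (ε + 4 / √q + 2 * (t + 2 * q / k)) + 2 * t + ε)) ≤ D) :
    1 - (ENNReal.ofReal (η / δ) +
        2 ^ n₀ * (2 * (2 * k) ^ q * ENNReal.ofReal (Real.exp (-((k - q) * t ^ 2 / 2)))) +
        2 ^ 4 ^ r * ENNReal.ofReal (Real.exp (-(k * t ^ 2 / 2))) +
        2 ^ n₀ * (2 ^ k * (2 ^ k * ENNReal.ofReal (Real.exp (-(k ^ 2 * t ^ 2 / 2)))))) ≤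
      sampleLaw W k {v | deltaCut (cutDistF F) (sample W v.1) W ≤ D ∧
        deltaCut (cutDistF F) (graphonOfWeights v.2) W ≤ D + t} := by
  obtain ⟨B, hB, hgood⟩ := exists_volume_le_forall_deltaCut_le hF hW hk n₀ hε hr hη hq ht hδ
  set E : Set ((Fin k → unitInterval) × (Fin k × Fin k → Z)) := {v | ∃ (σ : Fin n₀ → ℤˣ)
      (S T : Finset (Fin k)), t * k ^ 2 < ∑ i ∈ S, ∑ j ∈ T,
          ∑ n : Fin n₀, (1 / 2 : ℝ) ^ (n.val + 1) * ((σ n : ℤ) : ℝ) *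
            (F (n + 1) (v.2 (i, j)) - ∫ z, F (n + 1) z ∂(W (v.1 i, v.1 j)))} with hEdef
  have hE : MeasurableSet E := by
    simp only [hEdef, Set.ofPred_exists]
    refine MeasurableSet.iUnion fun σ => MeasurableSet.iUnion fun S => MeasurableSet.iUnion fun T =>
      measurableSet_lt measurable_const <| Finset.measurable_sum _ fun i _ =>
        Finset.measurable_sum _ fun j _ => Finset.measurable_sum _ fun n _ =>
          Measurable.const_mul (Measurable.sub ?_ ?_) _
    · exact (F (n + 1)).continuous.measurable.comp ((measurable_pi_apply (i, j)).comp measurable_snd)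
    · exact (hW.isSubKernel.measurable_integral (F (n + 1))).comp
        (((measurable_pi_apply i).comp measurable_fst).prodMk
          ((measurable_pi_apply j).comp measurable_fst))
  refine hW.one_sub_le_sampleLaw hB hE (fun x => IsProbGraphon.pi_edges_exists_gt_le hF
    (fun i j => W (x i, x j)) (fun _ _ => hW.2 _) n₀ ht) fun v hvB hvE => ⟨?_, ?_⟩
  · refine (hgood v.1 hvB (fun i j => W (v.1 i, v.1 j)) (fun _ _ => hW.2 _) 0
      (fun σ S T => ?_)).trans ?_
    · simp
    · linarith
  · refine (hgood v.1 hvB (fun i j => Measure.dirac (v.2 (i, j))) (fun _ _ => inferInstance) t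
      (fun σ S T => ?_)).trans ?_
    · simp only [hEdef, Set.mem_ofPred_eq, not_exists, not_lt] at hvE
      have hdirac : ∀ n (z : Z), ∫ y, F n y ∂(Measure.dirac z) = F n z := fun n z =>
        integral_dirac' _ _ (F n).continuous.measurable.stronglyMeasurable
      simpa only [hdirac] using hvE σ S T
    · linarith

theorem deltaCut_le_one [OpensMeasurableSpace Z] {F : ℕ → BoundedContinuousFunction Z ℝ}
    (hF : IsConvDet F) {U W : Sq → Measure Z} (hU : IsSubKernel U)
    (hU1 : ∀ᵐ p, U p Set.univ = 1) (hW : IsProbGraphon W) : deltaCut (cutDistF F) U W ≤ 1 := by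
  have h := cutDistF_le hF hU hW.isSubKernel hU1 (.of_forall fun p => (hW.2 p).measure_univ) 0
    (K := 0) (fun S T _ _ => by simp)
  refine (deltaCut_le_of_isMP F U W (MeasurePreserving.id volume) Function.bijective_id).trans ?_
  change cutDistF F U W ≤ 1
  simpa using h

theorem deltaCut_stepKernel_le_one [OpensMeasurableSpace Z]
    {F : ℕ → BoundedContinuousFunction Z ℝ} (hF : IsConvDet F) {W : Sq → Measure Z}
    (hW : IsProbGraphon W) {k : ℕ} (hk : 0 < k) (μ : Fin k → Fin k → Measure Z)
    (hμ : ∀ i j, IsProbabilityMeasure (μ i j)) :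
    deltaCut (cutDistF F) (stepKernel μ) W ≤ 1 := by
  have : NeZero k := ⟨hk.ne'⟩
  exact deltaCut_le_one hF (isSubKernel_stepKernel μ hμ) (ae_stepKernel_univ μ hμ) hW

theorem pow_mul_le_ofReal_exp {c x : ℝ≥0∞} {a b : ℝ} (hc : c ≤ ENNReal.ofReal (Real.exp b))
    (hx : x ≤ ENNReal.ofReal (Real.exp a)) (n : ℕ) :
    c ^ n * x ≤ ENNReal.ofReal (Real.exp (n * b + a)) := by
  rw [Real.exp_add, Real.exp_nat_mul, ENNReal.ofReal_mul (by positivity),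
    ENNReal.ofReal_pow (by positivity)]
  gcongr

theorem two_le_ofReal_exp_one : (2 : ℝ≥0∞) ≤ ENNReal.ofReal (Real.exp 1) := by
  have h := Real.add_one_le_exp (1 : ℝ)
  exact ENNReal.ofReal_ofNat 2 ▸ ENNReal.ofReal_le_ofReal (by linarith)

theorem thousand_mul_pow_three_le_exp_half {L : ℝ} (hL : 441 ≤ L) :
    1000 * L ^ 3 ≤ Real.exp (L / 2) := by
  refine le_trans ?_ (Real.pow_div_factorial_le_exp (L / 2) (by linarith) 6)
  have h : (441 : ℝ) ^ 3 ≤ L ^ 3 := by gcongr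
  have h2 : (L / 2) ^ 6 / (Nat.factorial 6 : ℕ) = L ^ 3 * L ^ 3 / 46080 := by
    norm_num [Nat.factorial]; ring
  rw [h2]
  nlinarith [pow_pos (show 0 < L by linarith) 3]

theorem second_sampling_bad_le {k : ℕ} {L : ℝ} (hL : 441 ≤ L) (hk : (k : ℝ) = Real.exp L)
    {n₀ q r : ℕ} (hn₀ : n₀ ≤ L + 1) (hq : q ≤ 16 * L + 1) (hr : r ≤ L / 4 + 1) {t : ℝ}
    (ht : t ^ 2 = 4 / L) :
    ENNReal.ofReal (Real.exp (-k / (2 * L) - 2)) +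
        2 ^ n₀ * (2 * (2 * k) ^ q * ENNReal.ofReal (Real.exp (-((k - q) * t ^ 2 / 2)))) +
        2 ^ 4 ^ r * ENNReal.ofReal (Real.exp (-(k * t ^ 2 / 2))) +
        2 ^ n₀ * (2 ^ k * (2 ^ k * ENNReal.ofReal (Real.exp (-(k ^ 2 * t ^ 2 / 2))))) ≤
      ENNReal.ofReal (Real.exp (-k / (2 * L))) := by
  have h0 : 0 < L := by linarith
  set u := Real.exp (L / 2) with hu
  have hu1 : 1000 * L ^ 3 ≤ u := thousand_mul_pow_three_le_exp_half hL
  have hku : (k : ℝ) = u ^ 2 := by rw [hk, hu, ← Real.exp_nat_mul]; congr 1; push_cast; ring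
  have h2 := two_le_ofReal_exp_one
  have h2k : (2 * k : ℝ≥0∞) ≤ ENNReal.ofReal (Real.exp (1 + L)) := by
    rw [Real.exp_add, ENNReal.ofReal_mul (by positivity), ← hk, ENNReal.ofReal_natCast]
    gcongr
  have h4r : (4 : ℝ) ^ r ≤ 9 * u := by
    have he : Real.exp 1 ≤ 3 := by linarith [Real.exp_one_lt_d9]
    have he' : 2 ≤ Real.exp 1 := by linarith [Real.exp_one_gt_d9]
    calc (4 : ℝ) ^ r = 2 ^ (2 * r) := by rw [pow_mul]; norm_num
      _ ≤ Real.exp 1 ^ (2 * r) := by gcongr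
      _ = Real.exp (2 * r) := by rw [← Real.exp_nat_mul]; push_cast; ring_nf
      _ ≤ Real.exp ((1 + 1) + L / 2) := by gcongr; linarith
      _ = Real.exp 1 * Real.exp 1 * u := by rw [Real.exp_add, Real.exp_add]
      _ ≤ 3 * 3 * u := by gcongr
      _ = 9 * u := by ring
  have hL3 : 441 ^ 2 * L ≤ L ^ 3 := by
    nlinarith [mul_le_mul_of_nonneg_left (mul_self_le_mul_self (by norm_num) hL) h0.le]
  set M : ℝ := -k / (2 * L) - 2 with hM
  have hkL : u * (1000 * L ^ 2) ≤ k / L := by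
    rw [le_div_iff₀ h0, hku]
    nlinarith [mul_le_mul_of_nonneg_left hu1 (by positivity : 0 ≤ u)]
  have hM' : M = -(k / L) / 2 - 2 := by rw [hM]; field_simp
  have hterm₂ : 2 ^ n₀ * (2 * (2 * k) ^ q *
      ENNReal.ofReal (Real.exp (-((k - q) * t ^ 2 / 2)))) ≤ ENNReal.ofReal (Real.exp M) := by
    have := pow_mul_le_ofReal_exp h2 (pow_mul_le_ofReal_exp h2
      (pow_mul_le_ofReal_exp h2k (le_refl (ENNReal.ofReal
        (Real.exp (-((k - q) * t ^ 2 / 2))))) q) 1) n₀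
    rw [pow_one, ← mul_assoc 2] at this
    refine this.trans (ENNReal.ofReal_le_ofReal (Real.exp_le_exp.2 ?_))
    have e : -((k - q) * t ^ 2 / 2) = -2 * (k / L) + 2 * q / L := by rw [ht]; field_simp; ring
    have e1 : 2 * q / L ≤ q := by
      rw [div_le_iff₀ h0]; nlinarith [(Nat.cast_nonneg q : (0 : ℝ) ≤ q)]
    have e2 : q * (1 + L) ≤ (16 * L + 1) * (1 + L) := by gcongr
    rw [e, hM']
    have e3 : 1000 * L ^ 3 * (1000 * 1) ≤ u * (1000 * L ^ 2) := by
      gcongr; nlinarith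
    push_cast
    nlinarith [pow_pos h0 2]
  have hterm₃ : 2 ^ 4 ^ r * ENNReal.ofReal (Real.exp (-(k * t ^ 2 / 2))) ≤
      ENNReal.ofReal (Real.exp M) := by
    refine (pow_mul_le_ofReal_exp h2 le_rfl (4 ^ r)).trans
      (ENNReal.ofReal_le_ofReal (Real.exp_le_exp.2 ?_))
    have e : -(k * t ^ 2 / 2) = -2 * (k / L) := by rw [ht]; field_simp; ring
    have e3 : u * (1000 * 1) ≤ u * (1000 * L ^ 2) := by gcongr; nlinarith
    rw [e, hM']
    push_cast
    nlinarith
  have hterm₄ : 2 ^ n₀ * (2 ^ k * (2 ^ k * ENNReal.ofReal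
      (Real.exp (-(k ^ 2 * t ^ 2 / 2))))) ≤ ENNReal.ofReal (Real.exp M) := by
    refine (pow_mul_le_ofReal_exp h2 (pow_mul_le_ofReal_exp h2
      (pow_mul_le_ofReal_exp h2 le_rfl k) k) n₀).trans
      (ENNReal.ofReal_le_ofReal (Real.exp_le_exp.2 ?_))
    have e : -(k ^ 2 * t ^ 2 / 2 : ℝ) = -2 * (k * (k / L)) := by rw [ht]; field_simp; ring
    have e3 : 1000 * L ^ 3 * (1000 * 1) ≤ u * (1000 * L ^ 2) := by
      gcongr; nlinarith
    have e4 : L ≤ k := by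
      rw [hk]; linarith [Real.add_one_le_exp L]
    have e5 : (k : ℝ) * 10 ≤ k * (k / L) := by gcongr; nlinarith
    have e6 : k / L ≤ k := div_le_self (by positivity) (by linarith)
    rw [e, hM']
    linarith
  calc _ ≤ ENNReal.ofReal (Real.exp M) + ENNReal.ofReal (Real.exp M) +
        ENNReal.ofReal (Real.exp M) + ENNReal.ofReal (Real.exp M) := by gcongr
    _ = 2 ^ 2 * ENNReal.ofReal (Real.exp M) := by ring
    _ ≤ _ := pow_mul_le_ofReal_exp h2 le_rfl 2
    _ = ENNReal.ofReal (Real.exp (-k / (2 * L))) := by rw [hM]; push_cast; ring_nf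

theorem second_sampling_error_le {k : ℕ} {s : ℝ} (hs : 21 ≤ s) (hk : (k : ℝ) = Real.exp (s ^ 2))
    {n₀ q : ℕ} (hn₀ : s ^ 2 ≤ n₀) (hq : 16 * s ^ 2 ≤ q) (hq' : q ≤ 16 * s ^ 2 + 1) {η : ℝ}
    (hη : η ≤ 1 / k) :
    (1 / 2) ^ n₀ + (η + ((1 / k + 1 / k) + (2 / s + 4 / √q + 2 * (2 / s + 2 * q / k)) +
      2 * (2 / s) + 2 / s)) ≤ 20 / s := by
  have h0 : 0 < s := by linarith
  have h441 : 441 ≤ s ^ 2 := by nlinarith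
  have hk1 : 1000 * (s ^ 2) ^ 3 ≤ (k : ℝ) := by
    rw [hk]
    exact (thousand_mul_pow_three_le_exp_half h441).trans (Real.exp_le_exp.2 (by linarith))
  have hk0 : 0 < (k : ℝ) := lt_of_lt_of_le (by positivity) hk1
  have h1 : (1 / 2 : ℝ) ^ n₀ ≤ 1 / s := by
    rw [one_div_pow]
    have : (n₀ : ℝ) < 2 ^ n₀ := by exact_mod_cast Nat.lt_two_pow_self
    exact one_div_le_one_div_of_le h0 (by nlinarith)
  have h2 : 4 / √q ≤ 1 / s := by
    have : 4 * s ≤ √q := Real.le_sqrt_of_sq_le (by nlinarith)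
    rw [div_le_div_iff₀ (by linarith) h0]
    linarith
  have h6 : s ^ 3 ≤ (s ^ 2) ^ 3 := by
    rw [← pow_mul]; exact pow_le_pow_right₀ (by linarith) (by norm_num)
  have h3 : 2 * q / k ≤ 1 / s := by
    rw [div_le_div_iff₀ hk0 h0]
    nlinarith
  have h4 : 1 / (k : ℝ) ≤ 1 / s := one_div_le_one_div_of_le h0 (by nlinarith)
  have e2 : 2 / s = 2 * (1 / s) := by ring
  have e20 : 20 / s = 20 * (1 / s) := by ring
  rw [e2, e20]
  linarith [one_div_pos.2 h0]

/-- **Second Sampling Lemma.**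
Let `F` be a convergence determining sequence, `W` a probability-graphon and `k ≥ 2`.
Consider the sample `X = (X₁, …, X_k)` of i.i.d. uniform random variables on `[0,1]`
together with the random weights `β = (β_{ij})` which, given `X`, are independent with
respective laws `W(X_i, X_j;·)` (their joint law is `sampleLaw W k`).  Then with
probability at least `1 − exp(−k/(2 ln k))`, one has both
`δ_{□,F}(W_X, W) ≤ 21/√(ln k)` and `δ_{□,F}(W_{𝔾(k,W)}, W) ≤ 22/√(ln k)`,
where `W_X` is the empirical stepfunction built from `X` and `𝔾(k,W)` is the random
weighted graph with weights `β`, identified with its associated stepfunction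
probability-graphon. -/
theorem second_sampling_lemma
    {Z : Type*} [MeasurableSpace Z] [TopologicalSpace Z] [PolishSpace Z] [BorelSpace Z]
    (F : ℕ → BoundedContinuousFunction Z ℝ) (hF : IsConvDet F)
    (W : Sq → Measure Z) (hW : IsProbGraphon W) (k : ℕ) (hk : 2 ≤ k) :
    ENNReal.ofReal (1 - Real.exp (-(k : ℝ) / (2 * Real.log k))) ≤
      sampleLaw W k
        {q | deltaCut (cutDistF F) (sample W q.1) W ≤ 21 / Real.sqrt (Real.log k) ∧
          deltaCut (cutDistF F) (graphonOfWeights q.2) W ≤ 22 / Real.sqrt (Real.log k)} := by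
  have hk0 : 0 < k := by lia
  set s := √(Real.log k) with hs
  have hlog : 0 < Real.log k := Real.log_pos (by exact_mod_cast hk)
  have hs0 : 0 < s := Real.sqrt_pos.2 hlog
  have hs2 : s ^ 2 = Real.log k := Real.sq_sqrt hlog.le
  rw [ENNReal.ofReal_sub _ (Real.exp_pos _).le, ENNReal.ofReal_one]
  obtain hs21 | hs21 := le_or_gt s 21
  · have h21 : 1 ≤ 21 / s := (one_le_div hs0).2 hs21
    have h22 : 1 ≤ 22 / s := (one_le_div hs0).2 (by linarith)
    have h := hW.one_sub_le_sampleLaw (k := k) (B := ∅) (b := 0) (e := 0) (by simp)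
      MeasurableSet.empty (by simp) (G := {q |
        deltaCut (cutDistF F) (sample W q.1) W ≤ 21 / s ∧
          deltaCut (cutDistF F) (graphonOfWeights q.2) W ≤ 22 / s}) fun v _ _ =>
      ⟨(deltaCut_stepKernel_le_one hF hW hk0 (fun i j => W (v.1 i, v.1 j))
          fun _ _ => hW.2 _).trans h21,
        (deltaCut_stepKernel_le_one hF hW hk0 (fun i j => Measure.dirac (v.2 (i, j)))
          fun _ _ => inferInstance).trans h22⟩
    refine le_trans ?_ h
    simp
  · have hL : 441 ≤ Real.log k := by nlinarith
    have hkexp : (k : ℝ) = Real.exp (Real.log k) := (Real.exp_log (by positivity)).symm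
    set L := Real.log k with hLdef
    set M : ℝ := -k / (2 * L) - 2 with hM
    set r := ⌊L / 4⌋₊ + 1 with hr
    have hr1 : L / 4 < r := by rw [hr]; push_cast; exact Nat.lt_floor_add_one _
    have hr2 : r ≤ L / 4 + 1 := by
      rw [hr]; push_cast; linarith [Nat.floor_le (show 0 ≤ L / 4 by linarith)]
    have hk1 : (0 : ℝ) < 1 / k := by positivity
    have hq1 := Nat.le_ceil (16 * L)
    have hq2 := (Nat.ceil_lt_add_one (show 0 ≤ 16 * L by linarith)).le
    have hts : (2 / s) ^ 2 = 4 / L := by rw [div_pow, hs2]; norm_num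
    have hη : 1 / k * Real.exp M ≤ 1 / k := by
      refine mul_le_of_le_one_right hk1.le (Real.exp_le_one_iff.2 ?_)
      have : 0 ≤ k / (2 * L) := by positivity
      rw [hM, neg_div]; linarith
    have hD := second_sampling_error_le hs21.le (by rwa [hs2]) (n₀ := ⌈L⌉₊)
      (by rw [hs2]; exact Nat.le_ceil L) (by rwa [hs2]) (by rwa [hs2]) hη
    have h := hW.one_sub_le_sampleLaw_deltaCut_le hF hk0 ⌈L⌉₊ (by positivity) (r := r)
      (by rw [hts, mul_div_assoc', lt_div_iff₀ hlog]; linarith)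
      (mul_pos hk1 (Real.exp_pos M)) (Nat.ceil_pos.2 (by linarith)) (by positivity) hk1 hD
    rw [mul_div_cancel_left₀ _ hk1.ne'] at h
    refine (tsub_le_tsub_left (second_sampling_bad_le hL hkexp
      (Nat.ceil_lt_add_one hlog.le).le hq2 hr2 hts) 1).trans (h.trans (measure_mono ?_))
    refine fun v hv => ⟨hv.1.trans ?_, hv.2.trans (le_of_eq (by ring))⟩
    gcongr
    norm_num

end PG
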